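/- arXiv:math/0305029 — 3 statements merged into one kernel-verified Lean document; each statement's English description precedes it below -/
import Mathlib

section
/- For linear chains ℒ = [X] and ℒ' = [Y] (X, Y ∈ ℤ*), the following are equivalent: (1) ℒ ~ ℒ' as weighted graphs; (2) hodge(X) = hodge(Y), det(X) = det(Y), and, with d = det(X), the images in ℤ/dℤ of the sets {det₁(X), det₁(X⁻)} and {det₁(Y), det₁(Y⁻)} have a common element. -/
/-- A weighted graph: a finite simple graph (vertices drawn from ℕ)
with an integer weight attached to each vertex. -/
structure WGraph where
  verts : Finset ℕ
  adj : ℕ → ℕ → Bool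
  symm : ∀ u v, adj u v = adj v u
  irrefl : ∀ v, adj v v = false
  adj_mem : ∀ u v, adj u v = true → u ∈ verts ∧ v ∈ verts
  wt : ℕ → ℤ

/-- Isomorphism of weighted graphs. -/
def WGraph.Iso (G G' : WGraph) : Prop :=
  ∃ f : ℕ → ℕ, Set.BijOn f ↑G.verts ↑G'.verts ∧
    (∀ u ∈ G.verts, ∀ v ∈ G.verts, (G'.adj (f u) (f v) = G.adj u v)) ∧
    (∀ v ∈ G.verts, G'.wt (f v) = G.wt v)

/-- Degree of a vertex: its number of neighbours. -/
def WGraph.deg (G : WGraph) (v : ℕ) : ℕ :=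
  (G.verts.filter (fun u => G.adj v u)).card

/-- `G'` is the blowing-up of `G` at the vertex `v`, with created vertex `e`:
`e` gets weight `-1` and is joined to `v`, and the weight of `v` drops by `1`. -/
def IsVertexBlowup (G G' : WGraph) (v e : ℕ) : Prop :=
  v ∈ G.verts ∧ e ∉ G.verts ∧
  G'.verts = insert e G.verts ∧
  (∀ a b, G'.adj a b = true ↔
    (G.adj a b = true ∨ (a = e ∧ b = v) ∨ (a = v ∧ b = e))) ∧
  G'.wt e = -1 ∧ G'.wt v = G.wt v - 1 ∧
  (∀ a ∈ G.verts, a ≠ v → G'.wt a = G.wt a)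

/-- `G'` is the blowing-up of `G` at the edge `{v₁, v₂}`, with created vertex `e`:
the edge `{v₁,v₂}` is removed, `e` gets weight `-1` and is joined to `v₁` and `v₂`,
and the weights of `v₁`, `v₂` drop by `1`. -/
def IsEdgeBlowup (G G' : WGraph) (v₁ v₂ e : ℕ) : Prop :=
  G.adj v₁ v₂ = true ∧ e ∉ G.verts ∧
  G'.verts = insert e G.verts ∧
  (∀ a b, G'.adj a b = true ↔
    ((G.adj a b = true ∧ ¬(a = v₁ ∧ b = v₂) ∧ ¬(a = v₂ ∧ b = v₁)) ∨
     (a = e ∧ (b = v₁ ∨ b = v₂)) ∨ (b = e ∧ (a = v₁ ∨ a = v₂)))) ∧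
  G'.wt e = -1 ∧ G'.wt v₁ = G.wt v₁ - 1 ∧ G'.wt v₂ = G.wt v₂ - 1 ∧
  (∀ a ∈ G.verts, a ≠ v₁ → a ≠ v₂ → G'.wt a = G.wt a)

/-- `G'` is the free blowing-up of `G`, with created vertex `e`: the disjoint union
of `G` and an isolated vertex `e` of weight `-1`. -/
def IsFreeBlowup (G G' : WGraph) (e : ℕ) : Prop :=
  e ∉ G.verts ∧ G'.verts = insert e G.verts ∧
  (∀ a b, G'.adj a b = G.adj a b) ∧
  G'.wt e = -1 ∧ (∀ a ∈ G.verts, G'.wt a = G.wt a)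

/-- `G'` is a blowing-up of `G`. -/
def WBlowup (G G' : WGraph) : Prop :=
  (∃ v e, IsVertexBlowup G G' v e) ∨ (∃ v₁ v₂ e, IsEdgeBlowup G G' v₁ v₂ e) ∨
  (∃ e, IsFreeBlowup G G' e)

/-- Equivalence of weighted graphs: generated by blowings-up, blowings-down and
isomorphisms of weighted graphs (graphs are considered up to isomorphism). -/
def WEquiv : WGraph → WGraph → Prop :=
  Relation.EqvGen (fun G G' => WBlowup G G' ∨ WGraph.Iso G G')

/-- The linear chain `[x₁, …, x_q]` associated with a sequence of integers:
consecutive vertices `0, 1, …, q-1` of weights `x₁, …, x_q`. -/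
def chainGraph (X : List ℤ) : WGraph where
  verts := Finset.range X.length
  adj := fun i j => decide (i < X.length ∧ j < X.length ∧ (i + 1 = j ∨ j + 1 = i))
  symm := by intro u v; simp only [decide_eq_decide]; omega
  irrefl := by intro v; simp only [decide_eq_false_iff_not]; omega
  adj_mem := by
    intro u v h
    simp only [decide_eq_true_eq] at h
    simp only [Finset.mem_range]
    omega
  wt := fun i => if h : i < X.length then X.get ⟨i, h⟩ else 0

/-- A weighted graph is a linear chain if it is isomorphic to `[X]` for some
finite sequence of integers `X`. -/
def IsLinearChain (G : WGraph) : Prop := ∃ X : List ℤ, WGraph.Iso G (chainGraph X)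

/-- The determinant of the matrix `-M(X)`, where `M(X)` is the intersection matrix of
the sequence `X` (diagonal `xᵢ`, `1` on the off-diagonals `|i-j| = 1`); `det(∅) = 1`. -/
def seqDet : List ℤ → ℤ
  | [] => 1
  | [x] => -x
  | x :: y :: l => -x * seqDet (y :: l) - seqDet l

/-- `det₁(x₁,…,xₙ) = det(x₂,…,xₙ)`, with `det₁(∅) = 0`. -/
def seqDet1 : List ℤ → ℤ
  | [] => 0
  | _ :: l => seqDet l

/-- The intersection form of the sequence `X`: the symmetric bilinear form on `ℝⁿ`
(`n = length of X`) whose matrix has `xᵢ` on the diagonal and `1` in positions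
`(i,j)` with `|i-j| = 1`, evaluated at `(v, v)`. -/
noncomputable def seqForm (X : List ℤ) (v : Fin X.length → ℝ) : ℝ :=
  ∑ i, ∑ j, v i * (if i = j then ((X.get i : ℤ) : ℝ)
    else if i.val + 1 = j.val ∨ j.val + 1 = i.val then 1 else 0) * v j

/-- `hodge(X)`: the maximal dimension of a linear subspace of `ℝⁿ` on which the
intersection form of `X` is nonnegative. -/
noncomputable def seqHodge (X : List ℤ) : ℕ :=
  sSup { k | ∃ W : Submodule ℝ (Fin X.length → ℝ),
      Module.finrank ℝ W = k ∧ ∀ v ∈ W, 0 ≤ seqForm X v }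

namespace LinearChain

theorem chainGraph_wt (X : List ℤ) (i : ℕ) : (chainGraph X).wt i = X.getD i 0 := by
  by_cases h : i < X.length <;> simp [chainGraph, h]

theorem chainGraph_adj {X : List ℤ} {i j : ℕ} : (chainGraph X).adj i j = true ↔
    i < X.length ∧ j < X.length ∧ (i + 1 = j ∨ j + 1 = i) := by
  simp [chainGraph]

/-- The chain `[X]` with vertices relabelled so as to skip the number `e`. -/
def skipGraph (X : List ℤ) (e : ℕ) : WGraph where
  verts := (Finset.range (X.length + 1)).erase e
  adj := fun i j => decide (i ≤ X.length ∧ j ≤ X.length ∧ i ≠ e ∧ j ≠ e ∧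
    (i + 1 = j ∨ j + 1 = i ∨ (i + 1 = e ∧ e + 1 = j) ∨ (j + 1 = e ∧ e + 1 = i)))
  symm := by intro u v; simp only [decide_eq_decide]; omega
  irrefl := by intro v; simp only [decide_eq_false_iff_not]; omega
  adj_mem := by
    intro u v h
    simp only [decide_eq_true_eq] at h
    simp only [Finset.mem_erase, Finset.mem_range]
    omega
  wt := fun i => X.getD (if i < e then i else i - 1) 0

theorem iso_skipGraph (X : List ℤ) (e : ℕ) (he : e ≤ X.length) :
    WGraph.Iso (chainGraph X) (skipGraph X e) := by
  refine ⟨fun i => if i < e then i else i + 1, ⟨?_, ?_, ?_⟩, ?_, ?_⟩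
  · intro i hi
    simp only [chainGraph, skipGraph, Finset.coe_range, Set.mem_Iio, Finset.coe_erase,
      Set.mem_sdiff, Set.mem_singleton_iff] at hi ⊢
    split_ifs <;> omega
  · intro i _ j _ hij
    simp only at hij
    split_ifs at hij <;> omega
  · intro j hj
    simp only [chainGraph, skipGraph, Finset.coe_range, Set.mem_Iio, Finset.coe_erase,
      Set.mem_sdiff, Set.mem_singleton_iff, Set.mem_image] at hj ⊢
    refine ⟨if j < e then j else j - 1, ?_, ?_⟩ <;> split_ifs <;> omega
  · intro u hu v hv
    simp only [chainGraph, Finset.mem_range] at hu hv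
    simp only [chainGraph, skipGraph, decide_eq_decide]
    split_ifs <;> omega
  · intro v hv
    rw [chainGraph_wt]
    simp only [skipGraph]
    congr 1
    split_ifs <;> omega

theorem wequiv_of_skip {X Y : List ℤ} (e : ℕ) (he : e ≤ X.length)
    (h : WBlowup (skipGraph X e) (chainGraph Y)) : WEquiv (chainGraph X) (chainGraph Y) :=
  .trans _ _ _ (.rel _ _ (.inr (iso_skipGraph X e he))) (.rel _ _ (.inl h))

theorem wequiv_nil : WEquiv (chainGraph []) (chainGraph [-1]) := by
  refine .rel _ _ (.inl (.inr (.inr ⟨0, ?_, ?_, ?_, ?_, ?_⟩)))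
  · simp [chainGraph]
  · simp [chainGraph]
  · intro a b
    simp only [chainGraph, List.length_nil, List.length_singleton, decide_eq_decide]
    omega
  · simp [chainGraph]
  · simp [chainGraph]

theorem wequiv_reverse (X : List ℤ) : WEquiv (chainGraph X) (chainGraph X.reverse) := by
  refine .rel _ _ (.inr ⟨fun i => X.length - 1 - i, ⟨?_, ?_, ?_⟩, ?_, ?_⟩)
  · intro i hi
    simp only [chainGraph, Finset.coe_range, Set.mem_Iio, List.length_reverse] at hi ⊢
    omega
  · intro i hi j hj hij
    simp only [chainGraph, Finset.coe_range, Set.mem_Iio] at hi hj hij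
    omega
  · intro i hi
    simp only [chainGraph, Finset.coe_range, Set.mem_Iio, List.length_reverse,
      Set.mem_image] at hi ⊢
    exact ⟨X.length - 1 - i, by omega, by omega⟩
  · intro u hu v hv
    simp only [chainGraph, Finset.mem_range] at hu hv
    simp only [chainGraph, decide_eq_decide, List.length_reverse]
    omega
  · intro v hv
    simp only [chainGraph, Finset.mem_range] at hv
    rw [chainGraph_wt, chainGraph_wt, List.getD_eq_getElem _ _ hv,
      List.getD_eq_getElem _ _ (by simp; omega), List.getElem_reverse]
    congr 1
    dsimp only
    omega

theorem wequiv_cons (a : ℤ) (B : List ℤ) :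
    WEquiv (chainGraph (a :: B)) (chainGraph (-1 :: (a - 1) :: B)) := by
  refine wequiv_of_skip 0 (by simp) (.inl ⟨1, 0, ?_, ?_, ?_, ?_, ?_, ?_, ?_⟩)
  · simp [skipGraph]
  · simp [skipGraph]
  · ext i
    simp only [chainGraph, skipGraph, Finset.mem_range, Finset.mem_insert, Finset.mem_erase,
      List.length_cons]
    omega
  · intro i j
    simp only [chainGraph_adj, skipGraph, decide_eq_true_eq, List.length_cons]
    omega
  · simp [chainGraph_wt]
  · simp [chainGraph_wt, skipGraph]
  · intro i hi hi1
    simp only [skipGraph, Finset.mem_erase] at hi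
    obtain ⟨j, rfl⟩ : ∃ j, i = j + 2 := ⟨i - 2, by omega⟩
    simp [chainGraph_wt, skipGraph]

theorem wequiv_mid (A B : List ℤ) (a b : ℤ) :
    WEquiv (chainGraph (A ++ a :: b :: B)) (chainGraph (A ++ (a - 1) :: -1 :: (b - 1) :: B)) := by
  refine wequiv_of_skip (A.length + 1) (by simp) (.inr (.inl
    ⟨A.length, A.length + 2, A.length + 1, ?_, ?_, ?_, ?_, ?_, ?_, ?_, ?_⟩))
  · simp [skipGraph]
  · simp [skipGraph]
  · ext i
    simp only [chainGraph, skipGraph, Finset.mem_range, Finset.mem_insert, Finset.mem_erase,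
      List.length_cons, List.length_append]
    omega
  · intro i j
    simp only [chainGraph_adj, skipGraph, decide_eq_true_eq, List.length_cons,
      List.length_append]
    omega
  · simp [chainGraph_wt]
  · simp [chainGraph_wt, skipGraph]
  · simp [chainGraph_wt, skipGraph]
  · intro i hi h0 h2
    simp only [skipGraph, Finset.mem_erase] at hi
    simp only [chainGraph_wt, skipGraph]
    rcases lt_or_ge i A.length with h | h
    · rw [List.getD_append _ _ _ _ h, if_pos (by omega), List.getD_append _ _ _ _ h]
    · obtain ⟨j, rfl⟩ : ∃ j, i = A.length + (j + 3) := ⟨i - A.length - 3, by omega⟩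
      rw [List.getD_append_right _ _ _ _ h, if_neg (by omega),
        List.getD_append_right _ _ _ _ (by omega)]
      simp

theorem seqDet_cons (x : ℤ) (l : List ℤ) : seqDet (x :: l) = -x * seqDet l - seqDet1 l := by
  cases l <;> simp [seqDet, seqDet1]

/-- The transfer matrix of a sequence of integers. -/
def transfer (X : List ℤ) : Matrix (Fin 2) (Fin 2) ℤ :=
  (X.map fun x => !![-x, -1; 1, 0]).prod

theorem transfer_cons (x : ℤ) (l : List ℤ) :
    transfer (x :: l) = !![-x, -1; 1, 0] * transfer l := by
  simp [transfer]

theorem transfer_append (A B : List ℤ) : transfer (A ++ B) = transfer A * transfer B := by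
  simp [transfer]

theorem transfer_zero_zero (X : List ℤ) : transfer X 0 0 = seqDet X ∧
    transfer X 1 0 = seqDet1 X := by
  induction X with
  | nil => simp [transfer, seqDet, seqDet1]
  | cons x l ih =>
    rw [transfer_cons, seqDet_cons]
    simp only [Matrix.mul_apply, Fin.sum_univ_two, ih.1, ih.2]
    simp [seqDet1, sub_eq_add_neg]

theorem transfer_reverse (X : List ℤ) :
    transfer X.reverse = !![1, 0; 0, -1] * (transfer X).transpose * !![1, 0; 0, -1] := by
  induction X with
  | nil => ext i j; fin_cases i <;> fin_cases j <;> simp [transfer, Matrix.mul_apply]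
  | cons x l ih =>
    rw [List.reverse_cons, transfer_append, ih, transfer_cons x l,
      show transfer [x] = !![-x, -1; 1, 0] by simp [transfer]]
    ext i j
    simp only [Matrix.mul_apply, Fin.sum_univ_two, Matrix.transpose_apply]
    fin_cases i <;> fin_cases j <;> simp <;> ring

theorem seqDet_reverse (X : List ℤ) : seqDet X.reverse = seqDet X := by
  rw [← (transfer_zero_zero X).1, ← (transfer_zero_zero _).1, transfer_reverse]
  simp only [Matrix.mul_apply, Fin.sum_univ_two]
  simp

theorem seqDet1_reverse (X : List ℤ) : seqDet1 X.reverse = -transfer X 0 1 := by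
  rw [← (transfer_zero_zero _).2, transfer_reverse]
  simp only [Matrix.mul_apply, Fin.sum_univ_two]
  simp

theorem det_transfer (X : List ℤ) : (transfer X).det = 1 := by
  induction X with
  | nil => simp [transfer]
  | cons x l ih => rw [transfer_cons, Matrix.det_mul, ih]; simp [Matrix.det_fin_two]

theorem seqDet1_mul_reverse (X : List ℤ) :
    seqDet1 X * seqDet1 X.reverse ≡ 1 [ZMOD seqDet X] := by
  have h := det_transfer X
  rw [Matrix.det_fin_two, (transfer_zero_zero X).1, (transfer_zero_zero X).2] at h
  rw [seqDet1_reverse]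
  refine Int.modEq_iff_dvd.2 ⟨transfer X 1 1, ?_⟩
  linear_combination -h

/-- Equivalence of sequences of integers through blowings-up and blowings-down of linear
chains and reversals. -/
inductive SeqEquiv : List ℤ → List ℤ → Prop
  | refl (X) : SeqEquiv X X
  | symm {X Y} : SeqEquiv X Y → SeqEquiv Y X
  | trans {X Y Z} : SeqEquiv X Y → SeqEquiv Y Z → SeqEquiv X Z
  | nil : SeqEquiv [] [-1]
  | reverse (X) : SeqEquiv X X.reverse
  | cons (a B) : SeqEquiv (a :: B) (-1 :: (a - 1) :: B)
  | mid (A B a b) : SeqEquiv (A ++ a :: b :: B) (A ++ (a - 1) :: -1 :: (b - 1) :: B)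

theorem SeqEquiv.wequiv {X Y : List ℤ} (h : SeqEquiv X Y) :
    WEquiv (chainGraph X) (chainGraph Y) := by
  induction h with
  | refl X => exact .refl _
  | symm _ ih => exact .symm _ _ ih
  | trans _ _ ih₁ ih₂ => exact .trans _ _ _ ih₁ ih₂
  | nil => exact wequiv_nil
  | reverse X => exact wequiv_reverse X
  | cons a B => exact wequiv_cons a B
  | mid A B a b => exact wequiv_mid A B a b

theorem SeqEquiv.seqDet_eq {X Y : List ℤ} (h : SeqEquiv X Y) : seqDet X = seqDet Y := by
  induction h with
  | refl X => rfl
  | symm _ ih => exact ih.symm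
  | trans _ _ ih₁ ih₂ => exact ih₁.trans ih₂
  | nil => simp [seqDet]
  | reverse X => exact (seqDet_reverse X).symm
  | cons a B =>
    simp only [seqDet_cons, seqDet1]
    ring
  | mid A B a b =>
    have h : transfer [a, b] = transfer [a - 1, -1, b - 1] := by
      ext i j
      fin_cases i <;> fin_cases j <;>
        simp [transfer, Matrix.mul_apply, Fin.sum_univ_two] <;> ring
    rw [← (transfer_zero_zero _).1, ← (transfer_zero_zero _).1, transfer_append,
      transfer_append, show a :: b :: B = [a, b] ++ B from rfl,
      show (a - 1) :: -1 :: (b - 1) :: B = [a - 1, -1, b - 1] ++ B from rfl,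
      transfer_append, transfer_append, h]

namespace SeqEquiv

instance : Trans SeqEquiv SeqEquiv SeqEquiv := ⟨SeqEquiv.trans⟩

theorem concat (A : List ℤ) (a : ℤ) : SeqEquiv (A ++ [a]) (A ++ [a - 1, -1]) := by
  have h := SeqEquiv.cons a A.reverse
  have h₁ := (SeqEquiv.reverse (a :: A.reverse)).symm.trans (h.trans (.reverse _))
  simpa using h₁

theorem shift_one (A B : List ℤ) (a b : ℤ) :
    SeqEquiv (A ++ a :: 0 :: b :: B) (A ++ (a + 1) :: 0 :: (b - 1) :: B) := by
  have h₁ := SeqEquiv.mid (A ++ [a]) B 0 b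
  have h₂ := SeqEquiv.mid A ((b - 1) :: B) (a + 1) 0
  simp only [zero_sub, add_sub_cancel_right, List.append_assoc, List.singleton_append] at h₁ h₂
  exact h₁.trans h₂.symm

theorem shift (A B : List ℤ) (a b t : ℤ) :
    SeqEquiv (A ++ a :: 0 :: b :: B) (A ++ (a + t) :: 0 :: (b - t) :: B) := by
  induction t with
  | zero => simpa using SeqEquiv.refl _
  | succ n ih =>
    have h := shift_one A B (a + n) (b - n)
    rw [add_assoc, sub_sub] at h
    exact ih.trans h
  | pred n ih =>
    have h := shift_one A B (a + (-n - 1)) (b - (-n - 1))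
    rw [show a + (-(n : ℤ) - 1) + 1 = a + -n by ring,
      show b - (-(n : ℤ) - 1) - 1 = b - -n by ring] at h
    exact ih.trans h.symm

theorem head_one (B : List ℤ) (b : ℤ) : SeqEquiv (0 :: b :: B) (0 :: (b - 1) :: B) := by
  have h₁ := SeqEquiv.mid [] B 0 b
  have h₂ := SeqEquiv.cons 0 ((b - 1) :: B)
  simp only [zero_sub, List.nil_append] at h₁ h₂
  exact h₁.trans h₂.symm

theorem head (B : List ℤ) (b c : ℤ) : SeqEquiv (0 :: b :: B) (0 :: c :: B) := by
  have key : ∀ (n : ℕ) (b : ℤ), SeqEquiv (0 :: b :: B) (0 :: (b - n) :: B) := by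
    intro n
    induction n with
    | zero => intro b; simpa using SeqEquiv.refl _
    | succ n ih =>
      intro b
      have h := (ih b).trans (head_one B _)
      rw [sub_sub] at h
      exact_mod_cast h
  rcases le_total c b with h | h
  · have := key (b - c).toNat b
    rwa [Int.toNat_of_nonneg (by omega), sub_sub_cancel] at this
  · have := key (c - b).toNat c
    rw [Int.toNat_of_nonneg (by omega), sub_sub_cancel] at this
    exact this.symm

theorem zeros_front (A B : List ℤ) : SeqEquiv (A ++ 0 :: 0 :: B) (0 :: 0 :: (A ++ B)) := by
  induction A using List.reverseRecOn generalizing B with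
  | nil => exact .refl _
  | append_singleton A a ih =>
    have h := shift A B a 0 (-a)
    simp only [add_neg_cancel, zero_sub, neg_neg] at h
    simpa using h.trans (ih (a :: B))

theorem zero_middle (A B : List ℤ) (a b : ℤ) :
    SeqEquiv (A ++ a :: 0 :: b :: B) (0 :: 0 :: (A ++ (a + b) :: B)) := by
  have h := shift A B a b (-a)
  simp only [add_neg_cancel, sub_neg_eq_add] at h
  rw [add_comm a b]
  exact h.trans (zeros_front A _)

theorem lower (A B : List ℤ) (n : ℕ) :
    ∃ B', (B ≠ [] → B' ≠ []) ∧ SeqEquiv (A ++ (n : ℤ) :: B) (A ++ 0 :: B') := by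
  induction n generalizing B with
  | zero => exact ⟨B, id, .refl _⟩
  | succ n ih =>
    cases B with
    | nil =>
      obtain ⟨B', -, h⟩ := ih [-1]
      have h₁ := concat A (n + 1)
      rw [add_sub_cancel_right] at h₁
      exact ⟨B', by simp, by exact_mod_cast h₁.trans h⟩
    | cons b B =>
      obtain ⟨B', h0, h⟩ := ih (-1 :: (b - 1) :: B)
      have h₁ := SeqEquiv.mid A B (n + 1) b
      rw [add_sub_cancel_right] at h₁
      exact ⟨B', by simpa using h0, by exact_mod_cast h₁.trans h⟩

theorem zero_reduce (A B : List ℤ) :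
    SeqEquiv (A ++ 0 :: B) [0] ∨ ∃ Z, SeqEquiv (A ++ 0 :: B) (0 :: 0 :: Z) := by
  have key : ∀ b B, SeqEquiv (0 :: b :: B) (0 :: 0 :: B) := fun b B => head B b 0
  rcases List.eq_nil_or_concat' A with rfl | ⟨A, a, rfl⟩
  · cases B with
    | nil => exact .inl (.refl _)
    | cons b B => exact .inr ⟨B, key b B⟩
  · right
    cases B with
    | nil =>
      refine ⟨A.reverse, (SeqEquiv.reverse _).trans ?_⟩
      simpa using key a A.reverse
    | cons b B => exact ⟨_, by simpa using zero_middle A B a b⟩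

theorem nonneg_reduce {X : List ℤ} {x : ℤ} (hx : x ∈ X) (h0 : 0 ≤ x) :
    SeqEquiv X [0] ∨ ∃ Z, SeqEquiv X (0 :: 0 :: Z) := by
  obtain ⟨A, B, rfl⟩ := List.append_of_mem hx
  lift x to ℕ using h0
  obtain ⟨B', -, h⟩ := lower A B x
  rcases zero_reduce A B' with h' | ⟨Z, h'⟩
  · exact .inl (h.trans h')
  · exact .inr ⟨Z, h.trans h'⟩

theorem neg_one_reduce {X : List ℤ} (hx : -1 ∈ X) :
    ∃ Z : List ℤ, Z.length < X.length ∧ SeqEquiv X Z := by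
  obtain ⟨A, B, rfl⟩ := List.append_of_mem hx
  rcases List.eq_nil_or_concat' A with rfl | ⟨A, a, rfl⟩
  · cases B with
    | nil => exact ⟨[], by simp, SeqEquiv.nil.symm⟩
    | cons b B =>
      have h := SeqEquiv.cons (b + 1) B
      rw [add_sub_cancel_right] at h
      exact ⟨(b + 1) :: B, by simp, h.symm⟩
  · cases B with
    | nil =>
      have h := concat A (a + 1)
      rw [add_sub_cancel_right] at h
      exact ⟨A ++ [a + 1], by simp, by simpa using h.symm⟩
    | cons b B =>
      have h := SeqEquiv.mid A B (a + 1) (b + 1)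
      rw [add_sub_cancel_right, add_sub_cancel_right] at h
      exact ⟨A ++ (a + 1) :: (b + 1) :: B, by simp, by simpa using h.symm⟩

theorem zeros_congr {X Y : List ℤ} (h : SeqEquiv X Y) :
    SeqEquiv (0 :: 0 :: X) (0 :: 0 :: Y) := by
  induction h with
  | refl X => exact .refl _
  | symm _ ih => exact ih.symm
  | trans _ _ ih₁ ih₂ => exact ih₁.trans ih₂
  | nil =>
    have h := concat [0] 0
    exact h.trans (head _ _ _)
  | reverse X =>
    have h := SeqEquiv.reverse (0 :: 0 :: X)
    have h₁ := zeros_front X.reverse []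
    simp only [List.reverse_cons, List.append_assoc, List.singleton_append,
      List.append_nil] at h h₁
    exact h.trans h₁
  | cons a B =>
    have h := SeqEquiv.mid [0] B 0 a
    exact h.trans (head _ _ _)
  | mid A B a b => exact SeqEquiv.mid (0 :: 0 :: A) B a b

end SeqEquiv

/-- The entries of the intersection matrix of a weighted graph. -/
def entry (G : WGraph) (a b : ℕ) : ℤ := if a = b then G.wt a else if G.adj a b then 1 else 0

/-- The number of neighbours of a vertex, as an integer. -/
def degree (G : WGraph) (a : ℕ) : ℤ := ∑ u ∈ G.verts, if G.adj a u then 1 else 0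

/-- The algebraic content of a blowing-up with new vertex `e`, where `β` is the column of the
intersection matrix of `G'` indexed by `e`. -/
structure IsAlgBlowup (G G' : WGraph) (e : ℕ) (β : ℕ → ℤ) : Prop where
  notMem : e ∉ G.verts
  verts : G'.verts = insert e G.verts
  entry_self : entry G' e e = -1
  entry_left : ∀ a ∈ G.verts, entry G' e a = β a
  entry_right : ∀ a ∈ G.verts, entry G' a e = β a
  entry_old : ∀ a ∈ G.verts, ∀ b ∈ G.verts, entry G a b = entry G' a b + β a * β b
  degree_eq : ((∀ a ∈ G.verts, degree G' a = degree G a) ∧ degree G' e = 2) ∨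
    (∃ v ∈ G.verts, (∀ a, β a = if a = v then 1 else 0) ∧
      (∀ a ∈ G.verts, degree G' a = degree G a + if a = v then 1 else 0) ∧ degree G' e = 1) ∨
    ((∀ a, β a = 0) ∧ ∀ a ∈ G.verts, degree G' a = degree G a)

theorem adj_eq_false_of_notMem {G : WGraph} {e : ℕ} (he : e ∉ G.verts) (a : ℕ) :
    G.adj a e = false ∧ G.adj e a = false := by
  constructor <;> by_contra h <;> rw [Bool.not_eq_false] at h
  · exact he (G.adj_mem _ _ h).2
  · exact he (G.adj_mem _ _ h).1

theorem isAlgBlowup_vertex {G G' : WGraph} {v e : ℕ} (h : IsVertexBlowup G G' v e) :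
    IsAlgBlowup G G' e (fun a => if a = v then 1 else 0) := by
  obtain ⟨hv, he, hV, hadj, hwe, hwv, hw⟩ := h
  have hve : v ≠ e := fun h => he (h ▸ hv)
  have hadj' : ∀ a b, (if G'.adj a b = true then (1 : ℤ) else 0) =
      if (G.adj a b = true ∨ (a = e ∧ b = v) ∨ (a = v ∧ b = e)) then 1 else 0 := by
    intro a b; simp only [hadj]
  have hne : ∀ a ∈ G.verts, a ≠ e := fun a ha h => he (h ▸ ha)
  refine ⟨he, hV, by simp [entry, hwe], ?_, ?_, ?_, ?_⟩
  · intro a ha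
    have := hne a ha
    simp only [entry, hadj', adj_eq_false_of_notMem he]
    grind
  · intro a ha
    have := hne a ha
    simp only [entry, hadj', adj_eq_false_of_notMem he]
    grind
  · intro a ha b hb
    have := hne a ha
    have := hne b hb
    simp only [entry, hadj']
    grind
  · right; left
    refine ⟨v, hv, fun a => rfl, fun a ha => ?_, ?_⟩
    · have := hne a ha
      simp only [degree, hV, Finset.sum_insert he, hadj', adj_eq_false_of_notMem he]
      rw [add_comm]
      congr 1
      · refine Finset.sum_congr rfl fun u hu => ?_
        have := hne u hu
        simp [*]
      · simp [this]
    · simp only [degree, hV, Finset.sum_insert he, hadj', adj_eq_false_of_notMem he]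
      simp [hve.symm, hv]

theorem isAlgBlowup_edge {G G' : WGraph} {v w e : ℕ} (h : IsEdgeBlowup G G' v w e) :
    IsAlgBlowup G G' e (fun a => (if a = v then 1 else 0) + if a = w then 1 else 0) := by
  obtain ⟨hvw, he, hV, hadj, hwe, hwv, hww, hw⟩ := h
  obtain ⟨hv, hw'⟩ := G.adj_mem _ _ hvw
  have hwv' : G.adj w v = true := (G.symm w v).trans hvw
  have hve : v ≠ e := fun h => he (h ▸ hv)
  have hwe' : w ≠ e := fun h => he (h ▸ hw')
  have hne' : v ≠ w := by rintro rfl; simp [G.irrefl] at hvw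
  have hne : ∀ a ∈ G.verts, a ≠ e := fun a ha h => he (h ▸ ha)
  have hadj' : ∀ a b, (if G'.adj a b = true then (1 : ℤ) else 0) =
      if ((G.adj a b = true ∧ ¬(a = v ∧ b = w) ∧ ¬(a = w ∧ b = v)) ∨
     (a = e ∧ (b = v ∨ b = w)) ∨ (b = e ∧ (a = v ∨ a = w))) then 1 else 0 := by
    intro a b; simp only [hadj]
  refine ⟨he, hV, by simp [entry, hwe], ?_, ?_, ?_, ?_⟩
  · intro a ha
    have := hne a ha
    simp only [entry, hadj', adj_eq_false_of_notMem he]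
    grind
  · intro a ha
    have := hne a ha
    simp only [entry, hadj', adj_eq_false_of_notMem he]
    grind
  · intro a ha b hb
    have := hne a ha
    have := hne b hb
    simp only [entry, hadj']
    grind
  · left
    refine ⟨fun a ha => ?_, ?_⟩
    · have := hne a ha
      have key : ∀ u ∈ G.verts, (if G'.adj a u = true then (1 : ℤ) else 0) =
          (if G.adj a u = true then 1 else 0) - (if u = w then (if a = v then 1 else 0) else 0)
            - (if u = v then (if a = w then 1 else 0) else 0) := by
        intro u hu
        have := hne u hu
        simp only [hadj']
        grind
      have key' : (if G'.adj a e = true then (1 : ℤ) else 0) =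
          (if a = v then 1 else 0) + if a = w then 1 else 0 := by
        simp only [hadj', adj_eq_false_of_notMem he]
        grind
      simp only [degree, hV, Finset.sum_insert he]
      rw [Finset.sum_congr rfl key, key', Finset.sum_sub_distrib, Finset.sum_sub_distrib,
        Finset.sum_ite_eq' _ w, Finset.sum_ite_eq' _ v, if_pos hv, if_pos hw']
      ring
    · have key : ∀ u ∈ insert e G.verts, (if G'.adj e u = true then (1 : ℤ) else 0) =
          (if u = v then 1 else 0) + if u = w then 1 else 0 := by
        intro u _
        simp only [hadj', adj_eq_false_of_notMem he]
        grind
      rw [degree, hV, Finset.sum_congr rfl key, Finset.sum_add_distrib,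
        Finset.sum_ite_eq' _ v, Finset.sum_ite_eq' _ w, if_pos (Finset.mem_insert_of_mem hv),
        if_pos (Finset.mem_insert_of_mem hw')]
      rfl

theorem isAlgBlowup_free {G G' : WGraph} {e : ℕ} (h : IsFreeBlowup G G' e) :
    IsAlgBlowup G G' e (fun _ => 0) := by
  obtain ⟨he, hV, hadj, hwe, hw⟩ := h
  have hne : ∀ a ∈ G.verts, a ≠ e := fun a ha h => he (h ▸ ha)
  refine ⟨he, hV, by simp [entry, hwe], ?_, ?_, ?_, ?_⟩
  · intro a ha
    simp [entry, hadj, adj_eq_false_of_notMem he, (hne a ha).symm]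
  · intro a ha
    simp [entry, hadj, adj_eq_false_of_notMem he, hne a ha]
  · intro a ha b hb
    simp [entry, hadj, hw a ha]
  · right; right
    refine ⟨fun a => rfl, fun a ha => ?_⟩
    simp [degree, hV, Finset.sum_insert he, hadj, adj_eq_false_of_notMem he]

theorem exists_isAlgBlowup {G G' : WGraph} (h : WBlowup G G') :
    ∃ e β, IsAlgBlowup G G' e β := by
  rcases h with ⟨v, e, h⟩ | ⟨v, w, e, h⟩ | ⟨e, h⟩
  · exact ⟨_, _, isAlgBlowup_vertex h⟩
  · exact ⟨_, _, isAlgBlowup_edge h⟩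
  · exact ⟨_, _, isAlgBlowup_free h⟩

theorem iso_symm {G G' : WGraph} (h : WGraph.Iso G G') : WGraph.Iso G' G := by
  obtain ⟨f, hf, hadj, hwt⟩ := h
  have hinv := hf.invOn_invFunOn
  have hg : Set.BijOn (Function.invFunOn f ↑G.verts) ↑G'.verts ↑G.verts :=
    hinv.symm.bijOn hf.surjOn.mapsTo_invFunOn hf.mapsTo
  refine ⟨Function.invFunOn f ↑G.verts, hg, fun u hu v hv => ?_, fun v hv => ?_⟩
  · rw [← hadj _ (hg.mapsTo hu) _ (hg.mapsTo hv), hinv.2 hu, hinv.2 hv]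
  · rw [← hwt _ (hg.mapsTo hv), hinv.2 hv]

/-- A predicate on weighted graphs that is invariant under algebraic blowings-up and
transfers backwards along isomorphisms is invariant under equivalence. -/
theorem iff_of_wequiv (P : WGraph → Prop)
    (hblow : ∀ G G' e β, IsAlgBlowup G G' e β → (P G ↔ P G'))
    (hiso : ∀ (G G' : WGraph) (f : ℕ → ℕ), Set.BijOn f ↑G.verts ↑G'.verts →
      (∀ u ∈ G.verts, ∀ v ∈ G.verts, entry G' (f u) (f v) = entry G u v) →
      (∀ u ∈ G.verts, degree G' (f u) = degree G u) → P G' → P G)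
    {G G' : WGraph} (h : WEquiv G G') : P G ↔ P G' := by
  have key : ∀ G G', WGraph.Iso G G' → P G' → P G := by
    rintro G G' ⟨f, hf, hadj, hwt⟩
    refine hiso G G' f hf (fun u hu v hv => ?_) (fun u hu => ?_)
    · simp only [entry, hf.injOn.eq_iff hu hv, hadj u hu v hv, hwt u hu]
    · refine (Finset.sum_nbij f hf.mapsTo hf.injOn hf.surjOn fun v hv => ?_).symm
      rw [hadj u hu v hv]
  induction h with
  | rel G G' h =>
    rcases h with h | h
    · obtain ⟨e, β, h⟩ := exists_isAlgBlowup h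
      exact hblow G G' e β h
    · exact ⟨key _ _ (iso_symm h), key _ _ h⟩
  | refl => rfl
  | symm _ _ _ ih => exact ih.symm
  | trans _ _ _ _ _ ih₁ ih₂ => exact ih₁.trans ih₂

section Label

variable {T : Type*} [AddCommGroup T]

/-- A labelling of the vertices of `G` by elements of `T` killed by the intersection matrix. -/
def IsLabel (G : WGraph) (f : ℕ → T) : Prop :=
  ∀ v ∈ G.verts, ∑ u ∈ G.verts, entry G v u • f u = 0

/-- The total of `degree - 2` over the vertices with label `t`. -/
def charge {T : Type*} [DecidableEq T] (G : WGraph) (f : ℕ → T) (t : T) : ℤ :=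
  ∑ v ∈ G.verts, if f v = t then degree G v - 2 else 0

/-- `c` is, away from `0`, the charge of some labelling of `G`. -/
def HasCharge [DecidableEq T] (G : WGraph) (c : T → ℤ) : Prop :=
  ∃ f : ℕ → T, IsLabel G f ∧ ∀ t, t ≠ 0 → charge G f t = c t

theorem isLabel_blowup {G G' : WGraph} {e : ℕ} {β : ℕ → ℤ} (h : IsAlgBlowup G G' e β)
    (f : ℕ → T) : IsLabel G' f ↔ IsLabel G f ∧ f e = ∑ u ∈ G.verts, β u • f u := by
  have h₁ : ∑ u ∈ G'.verts, entry G' e u • f u = -f e + ∑ u ∈ G.verts, β u • f u := by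
    rw [h.verts, Finset.sum_insert h.notMem, h.entry_self, neg_one_smul]
    congr 1
    exact Finset.sum_congr rfl fun u hu => by rw [h.entry_left u hu]
  have h₂ : ∀ v ∈ G.verts, ∑ u ∈ G'.verts, entry G' v u • f u =
      ∑ u ∈ G.verts, entry G v u • f u + β v • (f e - ∑ u ∈ G.verts, β u • f u) := by
    intro v hv
    have : ∑ u ∈ G.verts, entry G v u • f u = ∑ u ∈ G.verts, entry G' v u • f u +
        β v • ∑ u ∈ G.verts, β u • f u := by
      rw [Finset.smul_sum, ← Finset.sum_add_distrib]
      refine Finset.sum_congr rfl fun u hu => ?_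
      rw [h.entry_old v hv u hu, add_smul, mul_smul]
    rw [this, h.verts, Finset.sum_insert h.notMem, h.entry_right v hv, smul_sub]
    abel
  constructor
  · intro hf
    have he : f e = ∑ u ∈ G.verts, β u • f u := by
      have := hf e (by rw [h.verts]; exact Finset.mem_insert_self _ _)
      rw [h₁, neg_add_eq_zero] at this
      exact this
    refine ⟨fun v hv => ?_, he⟩
    have := hf v (by rw [h.verts]; exact Finset.mem_insert_of_mem hv)
    rwa [h₂ v hv, he, sub_self, smul_zero, add_zero] at this
  · rintro ⟨hf, he⟩ v hv
    rw [h.verts, Finset.mem_insert] at hv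
    rcases hv with rfl | hv
    · rw [h₁, he, neg_add_cancel]
    · rw [h₂ v hv, hf v hv, he, sub_self, smul_zero, add_zero]

theorem charge_blowup [DecidableEq T] {G G' : WGraph} {e : ℕ} {β : ℕ → ℤ} (h : IsAlgBlowup G G' e β)
    {f : ℕ → T} (he : f e = ∑ u ∈ G.verts, β u • f u) {t : T} (ht : t ≠ 0) :
    charge G' f t = charge G f t := by
  rw [charge, charge, h.verts, Finset.sum_insert h.notMem]
  rcases h.degree_eq with ⟨hd, hde⟩ | ⟨v, hv, hβ, hd, hde⟩ | ⟨hβ, hd⟩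
  · rw [hde, sub_self, ite_self, zero_add]
    exact Finset.sum_congr rfl fun a ha => by rw [hd a ha]
  · have hev : f e = f v := by simp [he, hβ, hv]
    have key : ∀ a ∈ G.verts, (if f a = t then degree G' a - 2 else 0) =
        (if f a = t then degree G a - 2 else 0) +
          if a = v then (if f v = t then 1 else 0) else 0 := by
      intro a ha
      rw [hd a ha]
      grind
    rw [Finset.sum_congr rfl key, Finset.sum_add_distrib, Finset.sum_ite_eq' _ v, if_pos hv,
      hde, hev]
    split_ifs <;> ring
  · have : f e ≠ t := by simpa [he, hβ] using ht.symm
    rw [if_neg this, zero_add]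
    exact Finset.sum_congr rfl fun a ha => by rw [hd a ha]

theorem hasCharge_iff_of_wequiv [DecidableEq T] (c : T → ℤ) {G G' : WGraph} (h : WEquiv G G') :
    HasCharge G c ↔ HasCharge G' c := by
  refine iff_of_wequiv (fun G => HasCharge G c) ?_ ?_ h
  · intro G G' e β h
    constructor
    · rintro ⟨f, hf, hc⟩
      have hne : ∀ u ∈ G.verts, u ≠ e := fun u hu h' => h.notMem (h' ▸ hu)
      set g := Function.update f e (∑ u ∈ G.verts, β u • f u)
      have hg : ∀ u ∈ G.verts, g u = f u := fun u hu => Function.update_of_ne (hne u hu) _ _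
      have hge : g e = ∑ u ∈ G.verts, β u • g u := by
        rw [Finset.sum_congr rfl fun u hu => by rw [hg u hu]]
        exact Function.update_self _ _ _
      refine ⟨g, (isLabel_blowup h g).2 ⟨fun v hv => ?_, hge⟩, fun t ht => ?_⟩
      · rw [Finset.sum_congr rfl fun u hu => by rw [hg u hu]]
        exact hf v hv
      · rw [charge_blowup h hge ht, ← hc t ht]
        exact Finset.sum_congr rfl fun u hu => by rw [hg u hu]
    · rintro ⟨f, hf, hc⟩
      obtain ⟨hf', he⟩ := (isLabel_blowup h f).1 hf
      exact ⟨f, hf', fun t ht => by rw [← charge_blowup h he ht, hc t ht]⟩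
  · rintro G G' φ hφ hentry hdeg ⟨f, hf, hc⟩
    refine ⟨f ∘ φ, fun v hv => ?_, fun t ht => ?_⟩
    · rw [← hf (φ v) (hφ.mapsTo hv)]
      refine Finset.sum_nbij φ hφ.mapsTo hφ.injOn hφ.surjOn fun u hu => ?_
      rw [hentry v hv u hu, Function.comp_apply]
    · rw [← hc t ht]
      refine Finset.sum_nbij φ hφ.mapsTo hφ.injOn hφ.surjOn fun u hu => ?_
      rw [hdeg u hu, Function.comp_apply]

theorem sum_entry_chain {M : Type*} [AddCommGroup M] (X : List ℤ) (f : ℕ → M) {i : ℕ}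
    (hi : i < X.length) :
    ∑ u ∈ (chainGraph X).verts, entry (chainGraph X) i u • f u =
      X.getD i 0 • f i + (if i = 0 then 0 else f (i - 1)) +
        if i + 1 < X.length then f (i + 1) else 0 := by
  have key : ∀ u ∈ Finset.range X.length, entry (chainGraph X) i u • f u =
      (if u = i then X.getD i 0 • f i else 0) +
      (if u = i - 1 then (if i = 0 then 0 else f (i - 1)) else 0) +
      (if u = i + 1 then f (i + 1) else 0) := by
    intro u hu
    rw [Finset.mem_range] at hu
    simp only [entry, chainGraph_adj, chainGraph_wt, hi, hu, true_and]
    rcases lt_trichotomy u i with h | rfl | h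
    · rcases eq_or_ne (u + 1) i with rfl | h'
      · simp
        omega
      · rw [if_neg (by omega), if_neg (by omega), if_neg (by omega), if_neg (by omega),
          if_neg (by omega)]
        simp
    · rcases eq_or_ne u 0 with rfl | h
      · simp
      · simp [show u ≠ u - 1 by omega]
    · rcases eq_or_ne u (i + 1) with rfl | h'
      · simp
        intro
        omega
      · rw [if_neg (by omega), if_neg (by omega), if_neg (by omega), if_neg (by omega),
          if_neg (by omega)]
        simp
  have hverts : (chainGraph X).verts = Finset.range X.length := rfl
  rw [hverts, Finset.sum_congr rfl key, Finset.sum_add_distrib, Finset.sum_add_distrib,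
    Finset.sum_ite_eq', Finset.sum_ite_eq', Finset.sum_ite_eq']
  simp only [Finset.mem_range]
  rw [if_pos hi, if_pos (by omega)]

theorem degree_chain (X : List ℤ) {i : ℕ} (hi : i < X.length) :
    degree (chainGraph X) i - 2 =
      -(if i = 0 then 1 else 0) - if i = X.length - 1 then 1 else 0 := by
  have h := sum_entry_chain X (fun _ => (1 : ℤ)) hi
  have key : ∀ u ∈ (chainGraph X).verts, entry (chainGraph X) i u • (1 : ℤ) =
      (if (chainGraph X).adj i u = true then 1 else 0) +
        if u = i then X.getD i 0 else 0 := by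
    intro u hu
    simp only [entry, chainGraph_wt]
    rcases eq_or_ne u i with rfl | h
    · simp [(chainGraph X).irrefl]
    · simp [h, h.symm]
  rw [Finset.sum_congr rfl key, Finset.sum_add_distrib, Finset.sum_ite_eq',
    if_pos (by simpa [chainGraph] using hi)] at h
  simp only [degree]
  simp only [smul_eq_mul, mul_one] at h
  split_ifs at h ⊢ <;> omega

theorem seqDet_take_reverse_succ (X : List ℤ) {i : ℕ} (hi : i < X.length) :
    seqDet (X.take (i + 1)).reverse =
      -X.getD i 0 * seqDet (X.take i).reverse - seqDet1 (X.take i).reverse := by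
  rw [List.take_succ_eq_append_getElem hi, List.reverse_append, List.reverse_singleton,
    List.singleton_append, seqDet_cons, List.getD_eq_getElem _ _ hi]

theorem seqDet1_take_reverse_succ (X : List ℤ) {i : ℕ} (hi : i < X.length) :
    seqDet1 (X.take (i + 1)).reverse = seqDet (X.take i).reverse := by
  rw [List.take_succ_eq_append_getElem hi, List.reverse_append, List.reverse_singleton,
    List.singleton_append, seqDet1]

theorem isLabel_chain_iff {X : List ℤ} (hX : X ≠ []) (f : ℕ → T) :
    IsLabel (chainGraph X) f ↔
      (∀ i < X.length, f i = seqDet (X.take i).reverse • f 0) ∧ seqDet X • f 0 = 0 := by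
  have hpos := List.length_pos_iff.2 hX
  have hmem : ∀ i, i ∈ (chainGraph X).verts ↔ i < X.length := by simp [chainGraph]
  have hlast : seqDet (X.take X.length).reverse = seqDet X := by
    rw [List.take_length, seqDet_reverse]
  constructor
  · intro hf
    have key : ∀ i ≤ X.length, (if i < X.length then f i else 0) =
        seqDet (X.take i).reverse • f 0 ∧
        (if i = 0 then 0 else f (i - 1)) = seqDet1 (X.take i).reverse • f 0 := by
      intro i
      induction i with
      | zero => simp [hpos, seqDet, seqDet1]
      | succ i ih =>
        intro hi
        obtain ⟨h₁, h₂⟩ := ih (by omega)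
        rw [if_pos (by omega)] at h₁
        have h := hf i ((hmem i).2 hi)
        rw [sum_entry_chain X f hi, h₂] at h
        rw [seqDet_take_reverse_succ X hi, seqDet1_take_reverse_succ X hi]
        refine ⟨?_, by simpa using h₁⟩
        rw [eq_neg_of_add_eq_zero_right h, h₁]
        module
    refine ⟨fun i hi => ?_, ?_⟩
    · rw [← (key i hi.le).1, if_pos hi]
    · rw [← hlast, ← (key _ le_rfl).1, if_neg (lt_irrefl _)]
  · rintro ⟨hf, h0⟩ i hi
    rw [hmem] at hi
    rw [sum_entry_chain X f hi]
    have h₁ : (if i + 1 < X.length then f (i + 1) else 0) =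
        seqDet (X.take (i + 1)).reverse • f 0 := by
      split_ifs with h
      · exact hf _ h
      · rw [show i + 1 = X.length by omega, hlast, h0]
    have h₂ : (if i = 0 then 0 else f (i - 1)) = seqDet1 (X.take i).reverse • f 0 := by
      cases i with
      | zero => simp [seqDet1]
      | succ i =>
        rw [seqDet1_take_reverse_succ X (by omega), ← hf i (by omega)]
        simp
    rw [h₁, h₂, hf i hi, seqDet_take_reverse_succ X hi]
    module

theorem charge_chain {T : Type*} [DecidableEq T] {X : List ℤ} (hX : X ≠ []) (f : ℕ → T) (t : T) :
    charge (chainGraph X) f t =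
      -(if f 0 = t then 1 else 0) - if f (X.length - 1) = t then 1 else 0 := by
  have hpos := List.length_pos_iff.2 hX
  have key : ∀ i ∈ Finset.range X.length,
      (if f i = t then degree (chainGraph X) i - 2 else 0) =
      -(if i = 0 then (if f 0 = t then 1 else 0) else 0) -
        if i = X.length - 1 then (if f (X.length - 1) = t then 1 else 0) else 0 := by
    intro i hi
    rw [degree_chain X (Finset.mem_range.1 hi)]
    grind
  have hverts : (chainGraph X).verts = Finset.range X.length := rfl
  rw [charge, hverts, Finset.sum_congr rfl key, Finset.sum_sub_distrib,
    Finset.sum_neg_distrib, Finset.sum_ite_eq', Finset.sum_ite_eq',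
    if_pos (Finset.mem_range.2 hpos), if_pos (Finset.mem_range.2 (by omega))]

theorem hasCharge_chain_iff [DecidableEq T] (X : List ℤ) (c : T → ℤ) :
    HasCharge (chainGraph X) c ↔ ∃ a : T, seqDet X • a = 0 ∧ ∀ t, t ≠ 0 →
      c t = -(if a = t then 1 else 0) - if seqDet1 X.reverse • a = t then 1 else 0 := by
  rcases eq_or_ne X [] with rfl | hX
  · constructor
    · rintro ⟨f, -, hf⟩
      refine ⟨0, by simp, fun t ht => ?_⟩
      rw [← hf t ht]
      simp [charge, chainGraph, ht.symm]
    · rintro ⟨a, ha, h⟩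
      have ha : a = 0 := by simpa [seqDet] using ha
      refine ⟨0, fun v hv => by simp, fun t ht => ?_⟩
      rw [h t ht]
      simp [charge, chainGraph, ha, ht.symm]
  · have hpos := List.length_pos_iff.2 hX
    have hq : seqDet (X.take (X.length - 1)).reverse = seqDet1 X.reverse := by
      rw [← seqDet1_take_reverse_succ X (by omega), Nat.sub_add_cancel hpos, List.take_length]
    constructor
    · rintro ⟨f, hf, hc⟩
      obtain ⟨h₁, h₂⟩ := (isLabel_chain_iff hX f).1 hf
      refine ⟨f 0, h₂, fun t ht => ?_⟩
      rw [← hc t ht, charge_chain hX, h₁ (X.length - 1) (by omega), hq]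
    · rintro ⟨a, ha, h⟩
      refine ⟨fun i => seqDet (X.take i).reverse • a, (isLabel_chain_iff hX _).2 ⟨?_, ?_⟩,
        fun t ht => ?_⟩
      · simp [seqDet]
      · simpa [seqDet] using ha
      · rw [h t ht, charge_chain hX, hq]
        simp [seqDet]

end Label

/-- The intersection form of a weighted graph. -/
noncomputable def form (G : WGraph) (v : ℕ → ℝ) : ℝ :=
  ∑ a ∈ G.verts, ∑ b ∈ G.verts, (entry G a b : ℝ) * v a * v b

/-- The intersection form of `G` is nonnegative on some `k`-dimensional space. -/
def HasNonneg (G : WGraph) (k : ℕ) : Prop :=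
  ∃ L : (Fin k → ℝ) →ₗ[ℝ] (ℕ → ℝ), (∀ w, (∀ a ∈ G.verts, L w a = 0) → w = 0) ∧
    ∀ w, 0 ≤ form G (L w)

theorem form_congr {G : WGraph} {v w : ℕ → ℝ} (h : ∀ a ∈ G.verts, v a = w a) :
    form G v = form G w :=
  Finset.sum_congr rfl fun a ha => Finset.sum_congr rfl fun b hb => by rw [h a ha, h b hb]

theorem form_blowup {G G' : WGraph} {e : ℕ} {β : ℕ → ℤ} (h : IsAlgBlowup G G' e β)
    (v : ℕ → ℝ) : form G' v = form G v - (v e - ∑ u ∈ G.verts, β u * v u) ^ 2 := by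
  set s := ∑ u ∈ G.verts, β u * v u with hs
  have h₁ : form G v = ∑ a ∈ G.verts, ∑ b ∈ G.verts, (entry G' a b : ℝ) * v a * v b +
      s * s := by
    rw [hs, Finset.sum_mul_sum, ← Finset.sum_add_distrib]
    refine Finset.sum_congr rfl fun a ha => ?_
    rw [← Finset.sum_add_distrib]
    refine Finset.sum_congr rfl fun b hb => ?_
    rw [h.entry_old a ha b hb]
    push_cast
    ring
  have h₂ : ∑ b ∈ G.verts, (entry G' e b : ℝ) * v e * v b = v e * s := by
    rw [hs, Finset.mul_sum]
    exact Finset.sum_congr rfl fun b hb => by rw [h.entry_left b hb]; ring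
  have h₃ : ∑ a ∈ G.verts, (entry G' a e : ℝ) * v a * v e = v e * s := by
    rw [hs, Finset.mul_sum]
    exact Finset.sum_congr rfl fun b hb => by rw [h.entry_right b hb]; ring
  rw [h₁, form, h.verts, Finset.sum_insert h.notMem, Finset.sum_insert h.notMem, h₂,
    Finset.sum_congr rfl fun a _ => Finset.sum_insert h.notMem, Finset.sum_add_distrib, h₃,
    h.entry_self]
  push_cast
  ring

theorem hasNonneg_iff_of_wequiv (k : ℕ) {G G' : WGraph} (h : WEquiv G G') :
    HasNonneg G k ↔ HasNonneg G' k := by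
  refine iff_of_wequiv (fun G => HasNonneg G k) ?_ ?_ h
  · intro G G' e β h
    have hne : ∀ u ∈ G.verts, u ≠ e := fun u hu h' => h.notMem (h' ▸ hu)
    have hmem : ∀ u ∈ G.verts, u ∈ G'.verts := fun u hu => by
      rw [h.verts]; exact Finset.mem_insert_of_mem hu
    constructor
    · rintro ⟨L, hL, hpos⟩
      let σ : (ℕ → ℝ) →ₗ[ℝ] ℝ := ∑ u ∈ G.verts, (β u : ℝ) • LinearMap.proj u
      have hσ : ∀ v, σ v = ∑ u ∈ G.verts, β u * v u := by intro v; simp [σ]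
      let L' : (Fin k → ℝ) →ₗ[ℝ] (ℕ → ℝ) :=
        LinearMap.pi fun i => if i = e then σ ∘ₗ L else LinearMap.proj i ∘ₗ L
      have hL'e : ∀ w, L' w e = σ (L w) := by intro w; simp [L']
      have hL' : ∀ w, ∀ u ∈ G.verts, L' w u = L w u := by
        intro w u hu
        simp [L', hne u hu]
      refine ⟨L', fun w hw => hL w fun a ha => ?_, fun w => ?_⟩
      · rw [← hL' w a ha, hw a (hmem a ha)]
      · rw [form_blowup h, hL'e, hσ, form_congr (hL' w),
          Finset.sum_congr rfl fun u hu => congrArg ((β u : ℝ) * ·) (hL' w u hu)]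
        simpa using hpos w
    · rintro ⟨L, hL, hpos⟩
      refine ⟨L, fun w hw => hL w ?_, fun w => ?_⟩
      · have h0 := hpos w
        rw [form_blowup h, form_congr (w := 0) (by simpa using hw),
          Finset.sum_congr rfl fun u hu => by rw [hw u hu, mul_zero]] at h0
        have he : L w e = 0 := by
          simp [form] at h0
          nlinarith [sq_nonneg (L w e)]
        intro a ha
        rw [h.verts, Finset.mem_insert] at ha
        rcases ha with rfl | ha
        · exact he
        · exact hw a ha
      · have := hpos w
        rw [form_blowup h] at this
        exact this.trans (sub_le_self _ (sq_nonneg _))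
  · rintro G G' φ hφ hentry - ⟨L, hL, hpos⟩
    refine ⟨LinearMap.funLeft ℝ ℝ φ ∘ₗ L, fun w hw => hL w fun a ha => ?_, fun w => ?_⟩
    · obtain ⟨b, hb, rfl⟩ := hφ.surjOn ha
      exact hw b hb
    · convert hpos w using 1
      refine Finset.sum_nbij φ hφ.mapsTo hφ.injOn hφ.surjOn fun u hu => ?_
      refine Finset.sum_nbij φ hφ.mapsTo hφ.injOn hφ.surjOn fun v hv => ?_
      simp [hentry u hu v hv, LinearMap.funLeft]

theorem seqForm_eq_form (X : List ℤ) (v : ℕ → ℝ) :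
    seqForm X (fun i => v i) = form (chainGraph X) v := by
  have hverts : (chainGraph X).verts = Finset.range X.length := rfl
  rw [seqForm, form, hverts, Finset.sum_range]
  refine Finset.sum_congr rfl fun i _ => ?_
  rw [Finset.sum_range]
  refine Finset.sum_congr rfl fun j _ => ?_
  simp only [entry, chainGraph_adj, chainGraph_wt, i.isLt, j.isLt, true_and, Fin.ext_iff,
    List.getD_eq_getElem _ _ i.isLt, List.get_eq_getElem]
  push_cast
  ring

theorem seqHodge_eq (X : List ℤ) : seqHodge X = sSup {k | HasNonneg (chainGraph X) k} := by
  have hmem : ∀ i, i ∈ (chainGraph X).verts ↔ i < X.length := by simp [chainGraph]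
  rw [seqHodge]
  congr 1
  ext k
  constructor
  · rintro ⟨W, hW, hpos⟩
    let φ : (Fin k → ℝ) ≃ₗ[ℝ] W := LinearEquiv.ofFinrankEq _ _ (by simp [hW])
    let E := Function.ExtendByZero.linearMap ℝ (Fin.val : Fin X.length → ℕ)
    have hE : ∀ (w : Fin X.length → ℝ) (i : Fin X.length), E w i = w i := fun w i =>
      Fin.val_injective.extend_apply _ _ _
    refine ⟨E ∘ₗ W.subtype ∘ₗ φ, fun w hw => ?_, fun w => ?_⟩
    · rw [← LinearEquiv.map_eq_zero_iff φ, ← Submodule.coe_eq_zero]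
      ext i
      rw [← hE (φ w : Fin X.length → ℝ) i]
      exact hw i ((hmem i).2 i.isLt)
    · rw [← seqForm_eq_form]
      convert hpos _ (φ w).2 using 2
      ext i
      exact hE _ i
  · rintro ⟨L, hL, hpos⟩
    let L' := LinearMap.funLeft ℝ ℝ (Fin.val : Fin X.length → ℕ) ∘ₗ L
    have hinj : Function.Injective L' := by
      rw [← LinearMap.ker_eq_bot, LinearMap.ker_eq_bot']
      intro w hw
      exact hL w fun a ha => congrFun hw ⟨a, (hmem a).1 ha⟩
    refine ⟨LinearMap.range L', by simpa using LinearMap.finrank_range_of_inj hinj, ?_⟩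
    rintro _ ⟨w, rfl⟩
    convert hpos w using 1
    exact seqForm_eq_form X (L w)

theorem seqHodge_eq_of_wequiv {X Y : List ℤ} (h : WEquiv (chainGraph X) (chainGraph Y)) :
    seqHodge X = seqHodge Y := by
  simp only [seqHodge_eq, hasNonneg_iff_of_wequiv _ h]

theorem le_length_of_hasNonneg {X : List ℤ} {k : ℕ} (h : HasNonneg (chainGraph X) k) :
    k ≤ X.length := by
  obtain ⟨L, hL, -⟩ := h
  let L' := LinearMap.funLeft ℝ ℝ (Fin.val : Fin X.length → ℕ) ∘ₗ L
  have hinj : Function.Injective L' := by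
    rw [← LinearMap.ker_eq_bot, LinearMap.ker_eq_bot']
    intro w hw
    exact hL w fun a ha => congrFun hw ⟨a, by simpa [chainGraph] using ha⟩
  simpa using LinearMap.finrank_le_finrank_of_injective hinj

theorem hasNonneg_zero (G : WGraph) : HasNonneg G 0 :=
  ⟨0, fun _ _ => Subsingleton.elim _ _, fun _ => by simp [form]⟩

theorem form_chain_cons (x : ℤ) (l : List ℤ) (v : ℕ → ℝ) :
    form (chainGraph (x :: l)) v = x * v 0 ^ 2 + (if l = [] then 0 else 2 * v 0 * v 1) +
      form (chainGraph l) (fun i => v (i + 1)) := by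
  have key : ∀ (X : List ℤ) (v : ℕ → ℝ), form (chainGraph X) v =
      ∑ i ∈ Finset.range X.length, v i * (X.getD i 0 • v i +
        (if i = 0 then 0 else v (i - 1)) + if i + 1 < X.length then v (i + 1) else 0) := by
    intro X v
    refine Finset.sum_congr rfl fun i hi => ?_
    rw [← sum_entry_chain X v (Finset.mem_range.1 hi), Finset.mul_sum]
    refine Finset.sum_congr rfl fun j _ => ?_
    rw [zsmul_eq_mul]
    ring
  rw [key, key, List.length_cons, Finset.sum_range_succ']
  have h : ∀ i ∈ Finset.range l.length, v (i + 1) * ((x :: l).getD (i + 1) 0 • v (i + 1) +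
      (if i + 1 = 0 then 0 else v (i + 1 - 1)) +
        if i + 1 + 1 < l.length + 1 then v (i + 1 + 1) else 0) =
      v (i + 1) * (l.getD i 0 • v (i + 1) + (if i = 0 then 0 else v (i - 1 + 1)) +
        if i + 1 < l.length then v (i + 1 + 1) else 0) +
      if i = 0 then v 0 * v 1 else 0 := by
    intro i _
    simp only [Nat.add_lt_add_iff_right]
    cases i with
    | zero => simp; ring
    | succ i => simp
  rw [Finset.sum_congr rfl h, Finset.sum_add_distrib, Finset.sum_ite_eq']
  cases l with
  | nil => simp; ring
  | cons y l => simp; ring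

theorem hasNonneg_zeros_iff (Z : List ℤ) (k : ℕ) :
    HasNonneg (chainGraph (0 :: 0 :: Z)) (k + 1) ↔ HasNonneg (chainGraph Z) k := by
  obtain ⟨c, hcZ, hc⟩ : ∃ c : ℝ, (Z = [] → c = 0) ∧ ∀ v : ℕ → ℝ, form (chainGraph (0 :: 0 :: Z)) v =
      2 * v 1 * (v 0 + c * v 2) + form (chainGraph Z) (fun i => v (i + 2)) := by
    refine ⟨if Z = [] then 0 else 1, fun h => if_pos h, fun v => ?_⟩
    rw [form_chain_cons, form_chain_cons]
    split_ifs <;> simp_all <;> ring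
  have hmem : ∀ (X : List ℤ) i, i ∈ (chainGraph X).verts ↔ i < X.length := by
    simp [chainGraph]
  constructor
  · rintro ⟨L, hL, hpos⟩
    let φ : (Fin (k + 1) → ℝ) →ₗ[ℝ] ℝ :=
      ((LinearMap.proj 0 : (ℕ → ℝ) →ₗ[ℝ] ℝ) + c • (LinearMap.proj 2 : (ℕ → ℝ) →ₗ[ℝ] ℝ) +
        (LinearMap.proj 1 : (ℕ → ℝ) →ₗ[ℝ] ℝ)) ∘ₗ L
    have hφ : ∀ w, φ w = L w 0 + c * L w 2 + L w 1 := fun w => by simp [φ]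
    have hk : k ≤ Module.finrank ℝ (LinearMap.ker φ) := by
      have h₁ := LinearMap.finrank_range_add_finrank_ker φ
      have h₂ := Submodule.finrank_le (LinearMap.range φ)
      simp only [Module.finrank_fin_fun, Module.finrank_self] at h₁ h₂
      omega
    obtain ⟨ι, hι⟩ : ∃ ι : (Fin k → ℝ) →ₗ[ℝ] LinearMap.ker φ, Function.Injective ι := by
      rw [← rank_le_iff_exists_linearMap, ← Module.finrank_eq_rank, ← Module.finrank_eq_rank,
        Module.finrank_fin_fun]
      exact_mod_cast hk
    have hform : ∀ w, 0 ≤ -2 * (L (ι w) 1) ^ 2 +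
        form (chainGraph Z) (fun i => L (ι w) (i + 2)) := by
      intro w
      have h := hpos (ι w)
      have h0 : φ (ι w) = 0 := (ι w).2
      rw [hφ] at h0
      rw [hc, show L (ι w) 0 + c * L (ι w) 2 = -L (ι w) 1 by linarith] at h
      linarith
    refine ⟨LinearMap.funLeft ℝ ℝ (fun i : ℕ => i + 2) ∘ₗ L ∘ₗ
      (LinearMap.ker φ).subtype ∘ₗ ι, fun w hw => ?_, fun w => ?_⟩
    · have hw' : ∀ i < Z.length, L (ι w) (i + 2) = 0 := fun i hi => hw i ((hmem Z i).2 hi)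
      have h := hform w
      rw [form_congr (w := 0) fun a ha => hw' a ((hmem Z a).1 ha)] at h
      have h1 : L (ι w) 1 = 0 := by
        simp only [form, Pi.zero_apply, mul_zero, Finset.sum_const_zero, add_zero] at h
        nlinarith [sq_nonneg (L (ι w) 1)]
      have h2 : c * L (ι w) 2 = 0 := by
        rcases eq_or_ne Z [] with hZ | hZ
        · rw [hcZ hZ, zero_mul]
        · rw [hw' 0 (List.length_pos_iff.2 hZ), mul_zero]
      have h0 : φ (ι w) = 0 := (ι w).2
      rw [hφ, h1, h2, add_zero, add_zero] at h0
      have hι0 := hL (ι w) fun a ha => by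
        rw [hmem] at ha
        rcases a with _ | _ | a
        · exact h0
        · exact h1
        · exact hw' a (by simpa using ha)
      exact hι (by rw [map_zero]; exact Subtype.ext hι0)
    · have := hform w
      have h' : 0 ≤ form (chainGraph Z) (fun i => L (ι w) (i + 2)) := by
        nlinarith [sq_nonneg (L (ι w) 1)]
      exact h'
  · rintro ⟨L, hL, hpos⟩
    let S : (Fin (k + 1) → ℝ) →ₗ[ℝ] (ℕ → ℝ) := L ∘ₗ LinearMap.funLeft ℝ ℝ Fin.succ
    let L' : (Fin (k + 1) → ℝ) →ₗ[ℝ] (ℕ → ℝ) := LinearMap.pi fun i =>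
      match i with
      | 0 => LinearMap.proj 0 - c • LinearMap.proj 0 ∘ₗ S
      | 1 => LinearMap.proj 0
      | i + 2 => LinearMap.proj i ∘ₗ S
    have h0 : ∀ w, L' w 0 = w 0 - c * S w 0 := fun w => by simp [L']
    have h1 : ∀ w, L' w 1 = w 0 := fun w => by simp [L']
    have h2 : ∀ w i, L' w (i + 2) = S w i := fun w i => by simp [L']
    refine ⟨L', fun w hw => ?_, fun w => ?_⟩
    · have hw0 : w 0 = 0 := by rw [← h1 w]; exact hw 1 ((hmem _ _).2 (by simp))
      have hw1 := hL (fun i => w i.succ) fun a ha => by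
        have := hw (a + 2) ((hmem _ _).2 (by simpa [hmem] using ha))
        rwa [h2] at this
      ext i
      refine Fin.cases hw0 (fun i => congrFun hw1 i) i
    · have : (fun i => L' w (i + 2)) = S w := funext (h2 w)
      rw [hc, this, h0, h1, show L' w 2 = S w 0 from h2 w 0, sub_add_cancel]
      have := hpos (fun i => w i.succ)
      have : 0 ≤ form (chainGraph Z) (S w) := this
      nlinarith [sq_nonneg (w 0)]

theorem seqHodge_zeros (Z : List ℤ) : seqHodge (0 :: 0 :: Z) = seqHodge Z + 1 := by
  have hb : BddAbove {k | HasNonneg (chainGraph Z) k} :=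
    ⟨Z.length, fun _ h => le_length_of_hasNonneg h⟩
  have hm := Nat.sSup_mem (s := {k | HasNonneg (chainGraph Z) k}) ⟨0, hasNonneg_zero _⟩ hb
  rw [seqHodge_eq, seqHodge_eq]
  refine IsGreatest.csSup_eq ⟨(hasNonneg_zeros_iff Z _).2 hm, ?_⟩
  rintro (_ | k) hk
  · exact Nat.zero_le _
  · exact Nat.succ_le_succ (le_csSup hb ((hasNonneg_zeros_iff Z k).1 hk))

theorem form_neg {X : List ℤ} (hX : ∀ x ∈ X, x ≤ -2) (v : ℕ → ℝ) :
    (form (chainGraph X) v ≤ if X = [] then 0 else -v 0 ^ 2) ∧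
      (0 ≤ form (chainGraph X) v → ∀ i < X.length, v i = 0) := by
  induction X generalizing v with
  | nil => simp [form, chainGraph]
  | cons x l ih =>
    obtain ⟨h₁, h₂⟩ := ih (fun y hy => hX y (List.mem_cons_of_mem _ hy)) (fun i => v (i + 1))
    have hx : (x : ℝ) ≤ -2 := by exact_mod_cast hX x List.mem_cons_self
    have hx' : x * v 0 ^ 2 ≤ -2 * v 0 ^ 2 := mul_le_mul_of_nonneg_right hx (sq_nonneg _)
    rw [form_chain_cons, if_neg (List.cons_ne_nil _ _)]
    have hle : x * v 0 ^ 2 + (if l = [] then 0 else 2 * v 0 * v 1) ≤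
        -v 0 ^ 2 + if l = [] then 0 else v 1 ^ 2 := by
      split_ifs <;> nlinarith [sq_nonneg (v 0 - v 1), sq_nonneg (v 0)]
    have hle' : x * v 0 ^ 2 + (if l = [] then 0 else 2 * v 0 * v 1) +
        form (chainGraph l) (fun i => v (i + 1)) ≤ -v 0 ^ 2 := by
      split_ifs at * <;> linarith
    refine ⟨hle', fun h => ?_⟩
    have hv0 : v 0 = 0 := by nlinarith [sq_nonneg (v 0)]
    rw [hv0] at h
    rintro (_ | i) hi
    · exact hv0
    · exact h₂ (by simpa using h) i (by simpa using hi)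

theorem seqHodge_eq_zero {X : List ℤ} (hX : ∀ x ∈ X, x ≤ -2) : seqHodge X = 0 := by
  rw [seqHodge_eq]
  refine IsGreatest.csSup_eq ⟨hasNonneg_zero _, ?_⟩
  rintro (_ | k) ⟨L, hL, hpos⟩
  · exact le_rfl
  · have h := hL 1 fun a ha => (form_neg hX _).2 (hpos 1) a (by simpa [chainGraph] using ha)
    exact absurd (congrFun h 0) one_ne_zero

/-- Two sequences have the same Hodge index, determinant and discriminant class. -/
def SameInvariants (X Y : List ℤ) : Prop :=
  seqHodge X = seqHodge Y ∧ seqDet X = seqDet Y ∧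
    (seqDet1 X ≡ seqDet1 Y [ZMOD seqDet X] ∨
     seqDet1 X ≡ seqDet1 Y.reverse [ZMOD seqDet X] ∨
     seqDet1 X.reverse ≡ seqDet1 Y [ZMOD seqDet X] ∨
     seqDet1 X.reverse ≡ seqDet1 Y.reverse [ZMOD seqDet X])

theorem modEq_of_mul_modEq_one {d p p' q q' : ℤ} (hp : p * p' ≡ 1 [ZMOD d])
    (hq : q * q' ≡ 1 [ZMOD d]) (h : p ≡ q [ZMOD d]) : p' ≡ q' [ZMOD d] := by
  have h₁ : p' * (q * q') ≡ p' * 1 [ZMOD d] := hq.mul_left _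
  have h₂ : (p * p') * q' ≡ 1 * q' [ZMOD d] := hp.mul_right _
  have h₃ : p * (p' * q') ≡ q * (p' * q') [ZMOD d] := h.mul_right _
  rw [show p' * (q * q') = q * (p' * q') by ring, mul_one] at h₁
  rw [show p * p' * q' = p * (p' * q') by ring, one_mul] at h₂
  exact h₁.symm.trans (h₃.symm.trans h₂)

theorem sameInvariants_iff {X Y : List ℤ} : SameInvariants X Y ↔
    seqHodge X = seqHodge Y ∧ seqDet X = seqDet Y ∧
    (seqDet1 X ≡ seqDet1 Y [ZMOD seqDet X] ∨
     seqDet1 X ≡ seqDet1 Y.reverse [ZMOD seqDet X]) := by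
  refine and_congr_right fun _ => and_congr_right fun hd => ⟨?_, by tauto⟩
  have hX := seqDet1_mul_reverse X
  have hY := seqDet1_mul_reverse Y
  rw [← hd] at hY
  have hX' := (mul_comm (seqDet1 X) _) ▸ hX
  have hY' := (mul_comm (seqDet1 Y) _) ▸ hY
  rintro (h | h | h | h)
  · exact .inl h
  · exact .inr h
  · exact .inr (modEq_of_mul_modEq_one hX' hY h)
  · exact .inl (modEq_of_mul_modEq_one hX' hY' h)

theorem SameInvariants.symm {X Y : List ℤ} (h : SameInvariants X Y) : SameInvariants Y X := by
  obtain ⟨h₁, h₂, h₃⟩ := h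
  refine ⟨h₁.symm, h₂.symm, ?_⟩
  rw [← h₂]
  rcases h₃ with h | h | h | h <;> simp only [h.symm, true_or, or_true]

theorem SameInvariants.trans {X Y Z : List ℤ} (h : SameInvariants X Y)
    (h' : SameInvariants Y Z) : SameInvariants X Z := by
  obtain ⟨h₁, h₂, h₃⟩ := sameInvariants_iff.1 h
  obtain ⟨h₁', h₂', h₃'⟩ := h'
  rw [← h₂] at h₃'
  have hY := seqDet1_mul_reverse Y
  have hZ := seqDet1_mul_reverse Z
  rw [← h₂', ← h₂] at hZ
  rw [← h₂] at hY
  have hY' := (mul_comm (seqDet1 Y) _) ▸ hY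
  have hZ' := (mul_comm (seqDet1 Z) _) ▸ hZ
  refine sameInvariants_iff.2 ⟨h₁.trans h₁', h₂.trans h₂', ?_⟩
  rcases h₃ with h | h
  · rcases h₃' with h' | h' | h' | h'
    · exact .inl (h.trans h')
    · exact .inr (h.trans h')
    · exact .inr (h.trans (modEq_of_mul_modEq_one hY' hZ h'))
    · exact .inl (h.trans (modEq_of_mul_modEq_one hY' hZ' h'))
  · rcases h₃' with h' | h' | h' | h'
    · exact .inr (h.trans (modEq_of_mul_modEq_one hY hZ h'))
    · exact .inl (h.trans (modEq_of_mul_modEq_one hY hZ' h'))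
    · exact .inl (h.trans h')
    · exact .inr (h.trans h')

/-- The sequence `0, 0, …, 0, 0, X` with `2k` zeros. -/
def zeros (k : ℕ) (X : List ℤ) : List ℤ := (fun Z => 0 :: 0 :: Z)^[k] X

theorem zeros_succ (k : ℕ) (X : List ℤ) : zeros (k + 1) X = 0 :: 0 :: zeros k X :=
  Function.iterate_succ_apply' _ _ _

theorem seqHodge_zeros_eq (k : ℕ) (X : List ℤ) : seqHodge (zeros k X) = seqHodge X + k := by
  induction k with
  | zero => rfl
  | succ k ih => rw [zeros_succ, seqHodge_zeros, ih]; rfl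

theorem seqDet_zeros (k : ℕ) (X : List ℤ) : seqDet (zeros k X) = (-1) ^ k * seqDet X ∧
    seqDet1 (zeros k X) = (-1) ^ k * seqDet1 X := by
  induction k with
  | zero => simp [zeros]
  | succ k ih =>
    rw [zeros_succ, seqDet_cons, seqDet1, seqDet1, seqDet_cons, ih.1, ih.2]
    constructor <;> ring

theorem SeqEquiv.zeros {X Y : List ℤ} (h : SeqEquiv X Y) (k : ℕ) :
    SeqEquiv (zeros k X) (zeros k Y) := by
  induction k with
  | zero => exact h
  | succ k ih => rw [zeros_succ, zeros_succ]; exact ih.zeros_congr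

theorem exists_normalForm (X : List ℤ) : ∃ k A, SeqEquiv X (zeros k A) ∧
    ((∀ x ∈ A, x ≤ -2) ∨ A = [0]) := by
  by_cases h : ∃ x ∈ X, 0 ≤ x
  · obtain ⟨x, hx, h0⟩ := h
    rcases SeqEquiv.nonneg_reduce hx h0 with h | ⟨Z, h⟩
    · exact ⟨0, [0], h, .inr rfl⟩
    · have hlt : seqHodge Z < seqHodge X := by
        rw [seqHodge_eq_of_wequiv h.wequiv, seqHodge_zeros]
        exact Nat.lt_succ_self _
      obtain ⟨k, A, hA, hA'⟩ := exists_normalForm Z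
      exact ⟨k + 1, A, h.trans (by rw [zeros_succ]; exact hA.zeros_congr), hA'⟩
  · by_cases h1 : -1 ∈ X
    · obtain ⟨Z, hlt, h⟩ := SeqEquiv.neg_one_reduce h1
      have heq : seqHodge Z = seqHodge X := (seqHodge_eq_of_wequiv h.wequiv).symm
      obtain ⟨k, A, hA, hA'⟩ := exists_normalForm Z
      exact ⟨k, A, h.trans hA, hA'⟩
    · refine ⟨0, X, .refl _, .inl fun x hx => ?_⟩
      have : x ≠ -1 := fun h => h1 (h ▸ hx)
      have : ¬ 0 ≤ x := fun h' => h ⟨x, hx, h'⟩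
      omega
termination_by (seqHodge X, X.length)
decreasing_by
  · exact Prod.Lex.left _ _ hlt
  · rw [heq]; exact Prod.Lex.right _ hlt

theorem seqDet1_lt_seqDet {A : List ℤ} (hA : ∀ x ∈ A, x ≤ -2) :
    0 ≤ seqDet1 A ∧ seqDet1 A < seqDet A := by
  induction A with
  | nil => simp [seqDet, seqDet1]
  | cons x l ih =>
    obtain ⟨h₁, h₂⟩ := ih fun y hy => hA y (List.mem_cons_of_mem _ hy)
    have hx := hA x List.mem_cons_self
    rw [seqDet_cons, seqDet1]
    constructor
    · omega
    · nlinarith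

theorem eq_of_seqDet_eq {A B : List ℤ} (hA : ∀ x ∈ A, x ≤ -2) (hB : ∀ x ∈ B, x ≤ -2)
    (h : seqDet A = seqDet B) (h₁ : seqDet1 A = seqDet1 B) : A = B := by
  induction A generalizing B with
  | nil =>
    cases B with
    | nil => rfl
    | cons y m =>
      have := seqDet1_lt_seqDet fun z hz => hB z (List.mem_cons_of_mem _ hz)
      simp only [seqDet1] at h₁
      omega
  | cons x l ih =>
    have hl : ∀ z ∈ l, z ≤ -2 := fun z hz => hA z (List.mem_cons_of_mem _ hz)
    cases B with
    | nil =>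
      have := seqDet1_lt_seqDet hl
      simp only [seqDet1] at h₁
      omega
    | cons y m =>
      have hm : ∀ z ∈ m, z ≤ -2 := fun z hz => hB z (List.mem_cons_of_mem _ hz)
      have hl' := seqDet1_lt_seqDet hl
      have hm' := seqDet1_lt_seqDet hm
      rw [seqDet1, seqDet1] at h₁
      rw [seqDet_cons, seqDet_cons, ← h₁] at h
      rw [← h₁] at hm'
      have hxy : x = y := by
        rcases lt_trichotomy x y with h' | h' | h'
        · nlinarith
        · exact h'
        · nlinarith
      subst hxy
      rw [ih hl hm h₁ (by linarith)]

theorem sign_seqDet (X : List ℤ) : 0 ≤ (-1) ^ seqHodge X * seqDet X := by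
  obtain ⟨k, A, h, hA⟩ := exists_normalForm X
  rw [seqHodge_eq_of_wequiv h.wequiv, h.seqDet_eq, seqHodge_zeros_eq, (seqDet_zeros k A).1]
  rcases hA with hA | rfl
  · have := seqDet1_lt_seqDet hA
    rw [seqHodge_eq_zero hA, zero_add, ← mul_assoc, ← mul_pow]
    simp
    omega
  · simp [seqDet]

theorem dvd_seqDet_of_wequiv {X Y : List ℤ} (h : WEquiv (chainGraph X) (chainGraph Y)) :
    seqDet X ∣ seqDet Y ∧ (seqDet1 X.reverse ≡ seqDet1 Y.reverse [ZMOD seqDet X] ∨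
      seqDet1 X.reverse * seqDet1 Y.reverse ≡ 1 [ZMOD seqDet X]) := by
  have hd : ∀ n : ℤ, (n : ZMod (seqDet X).natAbs) = 0 ↔ seqDet X ∣ n := fun n => by
    rw [ZMod.intCast_zmod_eq_zero_iff_dvd, Int.natAbs_dvd]
  have hm : ∀ m n : ℤ, (m : ZMod (seqDet X).natAbs) = n ↔ m ≡ n [ZMOD seqDet X] := fun m n => by
    rw [← sub_eq_zero, ← Int.cast_sub, hd, ← dvd_neg, neg_sub, Int.modEq_iff_dvd]
  by_cases h1 : (1 : ZMod (seqDet X).natAbs) = 0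
  · have h1 : seqDet X ∣ 1 := by rw [← hd]; exact_mod_cast h1
    exact ⟨h1.trans (one_dvd _), .inl (Int.modEq_iff_dvd.2 (h1.trans (one_dvd _)))⟩
  have hX := (hasCharge_chain_iff X (fun t : ZMod (seqDet X).natAbs =>
    -(if 1 = t then 1 else 0) - if seqDet1 X.reverse • 1 = t then 1 else 0)).2
      ⟨1, by rw [zsmul_one, hd], fun t _ => rfl⟩
  rw [hasCharge_iff_of_wequiv _ h, hasCharge_chain_iff] at hX
  obtain ⟨b, hb, hc⟩ := hX
  simp only [zsmul_eq_mul, mul_one] at hb hc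
  have hunit := seqDet1_mul_reverse X
  rw [← hm, Int.cast_mul, Int.cast_one] at hunit
  set p : ZMod (seqDet X).natAbs := ((seqDet1 X.reverse : ℤ) : ZMod (seqDet X).natAbs) with hp
  set q : ZMod (seqDet X).natAbs := ((seqDet1 Y.reverse : ℤ) : ZMod (seqDet X).natAbs) with hq
  have hp0 : p ≠ 0 := fun h => h1 (by rw [← hunit, h, mul_zero])
  have key : (b = 1 ∧ p = q) ∨ (q * b = 1 ∧ b = p) := by
    have e1 := hc 1 h1
    have ep := hc p hp0
    rw [if_pos rfl] at e1
    rw [if_pos rfl] at ep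
    by_cases hb1 : b = 1
    · subst hb1
      left
      refine ⟨rfl, ?_⟩
      simp only [mul_one] at e1 ep
      by_contra hne
      have hne' : q ≠ p := fun h => hne h.symm
      rw [if_neg hne'] at ep
      split_ifs at ep <;> omega
    · right
      rw [if_neg hb1] at e1
      have hqb : q * b = 1 := by
        by_contra hne
        rw [if_neg hne] at e1
        split_ifs at e1 <;> omega
      refine ⟨hqb, ?_⟩
      by_contra hne
      rw [hqb, if_neg hne] at ep
      split_ifs at ep <;> omega
  rcases key with ⟨rfl, h⟩ | ⟨h, rfl⟩
  · refine ⟨(hd _).1 (by simpa using hb), .inl ((hm _ _).1 h)⟩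
  · refine ⟨(hd _).1 ?_, .inr ((hm _ _).1 ?_)⟩
    · rw [← mul_one ((seqDet Y : ℤ) : ZMod (seqDet X).natAbs), ← h, mul_left_comm, hb, mul_zero]
    · rw [Int.cast_mul, mul_comm, Int.cast_one]
      exact h

theorem sameInvariants_of_wequiv {X Y : List ℤ} (h : WEquiv (chainGraph X) (chainGraph Y)) :
    SameInvariants X Y := by
  have hh := seqHodge_eq_of_wequiv h
  obtain ⟨h₁, h₂⟩ := dvd_seqDet_of_wequiv h
  obtain ⟨h₁', -⟩ := dvd_seqDet_of_wequiv (.symm _ _ h)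
  have hd : seqDet X = seqDet Y := by
    have hX := sign_seqDet X
    have hY := sign_seqDet Y
    rw [← hh] at hY
    rcases Int.natAbs_eq_natAbs_iff.1 (Int.natAbs_eq_of_dvd_dvd h₁ h₁') with h | h
    · exact h
    · rw [h] at hX ⊢
      have h0 : (-1 : ℤ) ^ seqHodge X * seqDet Y = 0 := by linarith
      have : seqDet Y = 0 := by simpa using h0
      simp [this]
  refine ⟨hh, hd, ?_⟩
  rcases h₂ with h | h
  · exact .inr (.inr (.inr h))
  · have hY := seqDet1_mul_reverse Y
    rw [← hd, mul_comm] at hY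
    rw [mul_comm] at h
    exact .inr (.inr (.inl (modEq_of_mul_modEq_one h hY rfl)))

theorem seqEquiv_of_negative {A B : List ℤ} (hA : ∀ x ∈ A, x ≤ -2) (hB : ∀ x ∈ B, x ≤ -2)
    (h : seqDet A = seqDet B) (h₁ : seqDet1 A ≡ seqDet1 B [ZMOD seqDet A] ∨
      seqDet1 A ≡ seqDet1 B.reverse [ZMOD seqDet A]) : SeqEquiv A B := by
  have key : ∀ C : List ℤ, (∀ x ∈ C, x ≤ -2) → seqDet A = seqDet C →
      seqDet1 A ≡ seqDet1 C [ZMOD seqDet A] → A = C := by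
    intro C hC hd hm
    have hA' := seqDet1_lt_seqDet hA
    have hC' := seqDet1_lt_seqDet hC
    refine eq_of_seqDet_eq hA hC hd ?_
    rwa [Int.ModEq, Int.emod_eq_of_lt hA'.1 hA'.2,
      Int.emod_eq_of_lt hC'.1 (hd ▸ hC'.2)] at hm
  rcases h₁ with h₁ | h₁
  · rw [key B hB h h₁]
    exact .refl _
  · rw [key B.reverse (by simpa using hB) (by rw [seqDet_reverse, h]) h₁]
    exact (SeqEquiv.reverse B).symm

theorem seqEquiv_of_sameInvariants {X Y : List ℤ} (h : SameInvariants X Y) :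
    SeqEquiv X Y := by
  obtain ⟨k, A, hX, hA⟩ := exists_normalForm X
  obtain ⟨l, B, hY, hB⟩ := exists_normalForm Y
  suffices SeqEquiv (zeros k A) (zeros l B) from hX.trans (this.trans hY.symm)
  have hZ := ((sameInvariants_of_wequiv hX.wequiv).symm.trans h).trans
    (sameInvariants_of_wequiv hY.wequiv)
  obtain ⟨hh, hd, h₁⟩ := sameInvariants_iff.1 hZ
  rw [seqHodge_zeros_eq, seqHodge_zeros_eq] at hh
  have h0 : seqDet [0] = 0 := rfl
  have hpow : ∀ n : ℕ, ((-1 : ℤ) ^ n) ≠ 0 := fun n => pow_ne_zero _ (by norm_num)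
  rw [(seqDet_zeros _ _).1, (seqDet_zeros _ _).1] at hd
  rcases hA with hA | rfl <;> rcases hB with hB | rfl
  · rw [seqHodge_eq_zero hA, seqHodge_eq_zero hB, zero_add, zero_add] at hh
    subst hh
    have hd' := mul_left_cancel₀ (hpow k) hd
    have hs : ((-1 : ℤ) ^ k) * (-1) ^ k = 1 := by rw [← mul_pow]; simp
    rw [(seqDet_zeros k A).1, (seqDet_zeros k A).2, (seqDet_zeros k B).2] at h₁
    have cancel : ∀ n : ℤ, (-1) ^ k * seqDet1 A ≡ (-1) ^ k * n [ZMOD seqDet A] →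
        seqDet1 A ≡ n [ZMOD seqDet A] := fun n h => by
      have := h.mul_left ((-1) ^ k)
      rwa [← mul_assoc, ← mul_assoc, hs, one_mul, one_mul] at this
    refine (seqEquiv_of_negative hA hB hd' ?_).zeros k
    refine h₁.imp (fun h => cancel _ h.of_mul_left) fun h => cancel _ (h.of_mul_left.trans ?_)
    have h₂ := (seqDet1_mul_reverse (zeros k B))
    have h₃ := seqDet1_mul_reverse B
    rw [(seqDet_zeros k B).1, (seqDet_zeros k B).2] at h₂
    rw [hd']
    refine modEq_of_mul_modEq_one h₂.of_mul_left ?_ rfl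
    rw [mul_mul_mul_comm, hs, one_mul]
    exact h₃
  · have := seqDet1_lt_seqDet hA
    rw [h0, mul_zero, mul_eq_zero] at hd
    have := hd.resolve_left (hpow k)
    omega
  · have := seqDet1_lt_seqDet hB
    rw [h0, mul_zero, eq_comm, mul_eq_zero] at hd
    have := hd.resolve_left (hpow l)
    omega
  · rw [add_left_cancel hh]
    exact .refl _

end LinearChain

/-- **Equivalence criterion for linear chains.** `[X] ~ [Y]` iff
`hodge(X) = hodge(Y)`, `det(X) = det(Y)`, and the images in `ℤ/dℤ` (`d = det(X)`) of
`{det₁(X), det₁(X⁻)}` and `{det₁(Y), det₁(Y⁻)}` have a common element. -/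
theorem linear_chain_equiv_iff (X Y : List ℤ) :
    WEquiv (chainGraph X) (chainGraph Y) ↔
      (seqHodge X = seqHodge Y ∧ seqDet X = seqDet Y ∧
       (seqDet1 X ≡ seqDet1 Y [ZMOD seqDet X] ∨
        seqDet1 X ≡ seqDet1 Y.reverse [ZMOD seqDet X] ∨
        seqDet1 X.reverse ≡ seqDet1 Y [ZMOD seqDet X] ∨
        seqDet1 X.reverse ≡ seqDet1 Y.reverse [ZMOD seqDet X])) :=
  ⟨LinearChain.sameInvariants_of_wequiv, fun h =>
    (LinearChain.seqEquiv_of_sameInvariants h).wequiv⟩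
end

section
/- If 𝒢 and 𝒢' are minimal weighted graphs and 𝒢 ~ 𝒢', then 𝒢 and 𝒢' are strictly equivalent. -/
/-- `G'` is a strict blowing-up of `G`: a blowing-up at an edge, or a blowing-up at
a vertex of degree at most 1. -/
def StrictBlowup (G G' : WGraph) : Prop :=
  (∃ v e, IsVertexBlowup G G' v e ∧ G.deg v ≤ 1) ∨
  (∃ v₁ v₂ e, IsEdgeBlowup G G' v₁ v₂ e)

/-- Strict equivalence of weighted graphs: generated by strict blowings-up, strict
blowings-down and isomorphisms. -/
def StrictEquiv : WGraph → WGraph → Prop :=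
  Relation.EqvGen (fun G G' => StrictBlowup G G' ∨ WGraph.Iso G G')

/-- A contractible vertex: weight `-1`, at most two neighbours, and no two distinct
neighbours adjacent to each other. -/
def WGraph.Contractible (G : WGraph) (e : ℕ) : Prop :=
  e ∈ G.verts ∧ G.wt e = -1 ∧ G.deg e ≤ 2 ∧
  ∀ v₁ v₂, G.adj e v₁ = true → G.adj e v₂ = true → v₁ ≠ v₂ → G.adj v₁ v₂ = false

/-- A weighted graph is minimal if it has no contractible vertex. -/
def WGraph.Minimal (G : WGraph) : Prop := ∀ e, ¬ G.Contractible e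

namespace WGraph

/-- The blowing-down of `G` at `e`: the vertex `e` is removed, its neighbours become pairwise
adjacent, and their weights increase by `1`. -/
def contract (G : WGraph) (e : ℕ) : WGraph where
  verts := G.verts.erase e
  adj := fun a b => decide (a ≠ e ∧ b ≠ e ∧
    (G.adj a b = true ∨ (a ≠ b ∧ G.adj e a = true ∧ G.adj e b = true)))
  symm := by
    intro u v
    have := G.symm u v
    simp only [decide_eq_decide]
    grind
  irrefl := by
    intro v
    have := G.irrefl v
    simp only [decide_eq_false_iff_not]
    grind
  adj_mem := by
    intro u v h
    simp only [decide_eq_true_eq] at h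
    have h₁ := G.adj_mem u v
    have h₂ := G.adj_mem e u
    have h₃ := G.adj_mem e v
    simp only [Finset.mem_erase]
    grind
  wt := fun a => if G.adj e a = true then G.wt a + 1 else G.wt a

variable {G H K : WGraph} {a b e f g v z : ℕ}

theorem contract_adj : (G.contract e).adj a b = true ↔ a ≠ e ∧ b ≠ e ∧
    (G.adj a b = true ∨ (a ≠ b ∧ G.adj e a = true ∧ G.adj e b = true)) := by
  simp [contract]

theorem contract_wt :
    (G.contract e).wt a = if G.adj e a = true then G.wt a + 1 else G.wt a := rfl

theorem mem_contract : a ∈ (G.contract e).verts ↔ a ≠ e ∧ a ∈ G.verts := by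
  simp [contract]

theorem deg_le_two_iff : G.deg v ≤ 2 ↔ ∀ a b c, G.adj v a = true → G.adj v b = true →
    G.adj v c = true → a = b ∨ a = c ∨ b = c := by
  have hmem := fun u => G.adj_mem v u
  rw [← not_lt, deg, Finset.two_lt_card]
  simp only [Finset.mem_filter]
  grind

theorem deg_le_one_iff : G.deg v ≤ 1 ↔ ∀ a b, G.adj v a = true → G.adj v b = true → a = b := by
  have hmem := fun u => G.adj_mem v u
  rw [deg, Finset.card_le_one]
  simp only [Finset.mem_filter]
  grind

theorem contractible_iff : G.Contractible e ↔ e ∈ G.verts ∧ G.wt e = -1 ∧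
    (∀ a b c, G.adj e a = true → G.adj e b = true → G.adj e c = true → a = b ∨ a = c ∨ b = c) ∧
    ∀ a b, G.adj e a = true → G.adj e b = true → a ≠ b → ¬ G.adj a b = true := by
  simp only [Contractible, deg_le_two_iff, Bool.not_eq_true]

theorem Contractible.mem (h : G.Contractible e) : e ∈ G.verts := h.1

theorem card_contract_lt (h : e ∈ G.verts) : (G.contract e).verts.card < G.verts.card :=
  Finset.card_erase_lt_of_mem h

/-! ### Isomorphisms -/

theorem Iso.strictEquiv (h : G.Iso H) : StrictEquiv G H :=
  .rel _ _ (.inr h)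

theorem iso_of_eqOn (hv : G.verts = H.verts)
    (hadj : ∀ u ∈ G.verts, ∀ v ∈ G.verts, (H.adj u v = true ↔ G.adj u v = true))
    (hwt : ∀ v ∈ G.verts, H.wt v = G.wt v) : G.Iso H :=
  ⟨id, by rw [hv]; exact Set.bijOn_id _,
    fun u hu v hv => Bool.eq_iff_iff.2 (hadj u hu v hv), hwt⟩

theorem Contractible.of_bijOn {φ : ℕ → ℕ} (hφ : Set.BijOn φ G.verts H.verts)
    (hadj : ∀ u ∈ G.verts, ∀ v ∈ G.verts, H.adj (φ u) (φ v) = G.adj u v)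
    (hwt : ∀ v ∈ G.verts, H.wt (φ v) = G.wt v) (he : G.Contractible e) :
    H.Contractible (φ e) := by
  rw [contractible_iff] at he ⊢
  obtain ⟨hmem, hw, hd, hn⟩ := he
  have hpre : ∀ a, H.adj (φ e) a = true → ∃ a' ∈ G.verts, φ a' = a ∧ G.adj e a' = true := by
    intro a ha
    obtain ⟨a', ha', rfl⟩ := hφ.surjOn (H.adj_mem _ _ ha).2
    exact ⟨a', ha', rfl, hadj e hmem a' ha' ▸ ha⟩
  refine ⟨hφ.mapsTo hmem, (hwt e hmem).trans hw, ?_, ?_⟩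
  · intro a b c ha hb hc
    obtain ⟨a, -, rfl, ha⟩ := hpre a ha
    obtain ⟨b, -, rfl, hb⟩ := hpre b hb
    obtain ⟨c, -, rfl, hc⟩ := hpre c hc
    grind
  · intro a b ha hb hab
    obtain ⟨a, ha', rfl, hea⟩ := hpre a ha
    obtain ⟨b, hb', rfl, heb⟩ := hpre b hb
    rw [hadj a ha' b hb']
    exact hn a b hea heb (fun h => hab (h ▸ rfl))

theorem Iso.contract (he : e ∈ G.verts) {φ : ℕ → ℕ} (hφ : Set.BijOn φ G.verts H.verts)
    (hadj : ∀ u ∈ G.verts, ∀ v ∈ G.verts, H.adj (φ u) (φ v) = G.adj u v)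
    (hwt : ∀ v ∈ G.verts, H.wt (φ v) = G.wt v) :
    (G.contract e).Iso (H.contract (φ e)) := by
  refine ⟨φ, ?_, ?_, ?_⟩
  · simpa [WGraph.contract] using hφ.sdiff_singleton he
  · intro u hu v hv
    rw [mem_contract] at hu hv
    have huv : φ u = φ v ↔ u = v := hφ.injOn.eq_iff hu.2 hv.2
    have hue : φ u = φ e ↔ u = e := hφ.injOn.eq_iff hu.2 he
    have hve : φ v = φ e ↔ v = e := hφ.injOn.eq_iff hv.2 he
    rw [Bool.eq_iff_iff, contract_adj, contract_adj, hadj u hu.2 v hv.2, hadj e he u hu.2,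
      hadj e he v hv.2, Ne, Ne, Ne, huv, hue, hve]
  · intro v hv
    rw [mem_contract] at hv
    rw [contract_wt, contract_wt, hadj e he v hv.2, hwt v hv.2]

/-! ### Blowings-up as inverses of contractions -/

theorem exists_contractible_of_wBlowup (h : WBlowup G H) :
    ∃ e, H.Contractible e ∧ G.Iso (H.contract e) := by
  have hmem := G.adj_mem
  have hsymm := G.symm
  have hirr := G.irrefl
  rcases h with ⟨v, e, hv, he, hV, hadj, hwe, hwv, hw⟩ |
    ⟨v, w, e, hvw, he, hV, hadj, hwe, hwv, hww, hw⟩ |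
    ⟨e, he, hV, hadj, hwe, hw⟩
  · refine ⟨e, contractible_iff.2 ⟨by simp [hV], hwe, ?_, ?_⟩, iso_of_eqOn ?_ ?_ ?_⟩
    · grind
    · grind
    · simp [contract, hV, he]
    · intro a ha b hb
      rw [contract_adj]
      grind
    · intro a ha
      rw [contract_wt]
      grind
  · refine ⟨e, contractible_iff.2 ⟨by simp [hV], hwe, ?_, ?_⟩, iso_of_eqOn ?_ ?_ ?_⟩
    · grind
    · grind
    · simp [contract, hV, he]
    · intro a ha b hb
      rw [contract_adj]
      grind
    · intro a ha
      rw [contract_wt]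
      grind
  · refine ⟨e, contractible_iff.2 ⟨by simp [hV], hwe, ?_, ?_⟩, iso_of_eqOn ?_ ?_ ?_⟩
    · grind
    · grind
    · simp [contract, hV, he]
    · intro a ha b hb
      rw [contract_adj]
      grind
    · intro a ha
      rw [contract_wt]
      grind

/-- Contracting a neighbour of a vertex of degree at most `2` is a strict blowing-down. -/
theorem strictBlowup_contract (hf : G.Contractible f) (hfz : G.adj f z = true)
    (hz : G.deg z ≤ 2) : StrictBlowup (G.contract f) G := by
  rw [contractible_iff] at hf
  rw [deg_le_two_iff] at hz
  obtain ⟨hmem, hw, hd, hn⟩ := hf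
  have hm := G.adj_mem
  have hsymm := G.symm
  have hirr := G.irrefl
  have hV : G.verts = insert f (G.contract f).verts := by simp [contract, hmem]
  by_cases hex : ∃ w, w ≠ z ∧ G.adj f w = true
  · obtain ⟨w, hwz, hfw⟩ := hex
    refine .inr ⟨z, w, f, ?_, ?_, hV, ?_, hw, ?_, ?_, ?_⟩
    · rw [contract_adj]; grind
    · simp [contract]
    · intro a b
      rw [contract_adj]
      grind
    · rw [contract_wt]; grind
    · rw [contract_wt]; grind
    · intro a ha haz haw
      rw [contract_wt]; grind
  · refine .inl ⟨z, f, ⟨?_, ?_, hV, ?_, hw, ?_, ?_⟩, ?_⟩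
    · rw [mem_contract]; grind
    · simp [contract]
    · intro a b
      rw [contract_adj]
      grind
    · rw [contract_wt]; grind
    · intro a ha haz
      rw [contract_wt]; grind
    · rw [deg_le_one_iff]
      intro a b
      rw [contract_adj, contract_adj]
      grind

theorem strictEquiv_contract (hf : G.Contractible f) (hfz : G.adj f z = true)
    (hz : G.deg z ≤ 2) : StrictEquiv (G.contract f) G :=
  .rel _ _ (.inl (strictBlowup_contract hf hfz hz))

/-! ### Minimal models -/

/-- `G.MinModel K` means that `K` is minimal and is obtained from `G` by a sequence of
contractions. -/
inductive MinModel : WGraph → WGraph → Prop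
  | of_minimal {G : WGraph} : G.Minimal → MinModel G G
  | contract {G K : WGraph} {e : ℕ} :
      G.Contractible e → MinModel (G.contract e) K → MinModel G K

theorem exists_minModel (G : WGraph) : ∃ K, MinModel G K := by
  by_cases h : G.Minimal
  · exact ⟨G, .of_minimal h⟩
  · simp only [Minimal, not_forall, not_not] at h
    obtain ⟨e, he⟩ := h
    have := card_contract_lt he.mem
    obtain ⟨K, hK⟩ := exists_minModel (G.contract e)
    exact ⟨K, .contract he hK⟩
termination_by G.verts.card

theorem MinModel.eq_of_minimal (h : MinModel G K) (hG : G.Minimal) : K = G := by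
  cases h with
  | of_minimal => rfl
  | contract he => exact absurd he (hG _)

theorem Iso.minimal (h : G.Iso H) (hG : G.Minimal) : H.Minimal := by
  obtain ⟨φ, hφ, hadj, hwt⟩ := h
  intro e he
  have hinv := hφ.invOn_invFunOn
  have hbij : Set.BijOn (Function.invFunOn φ G.verts) H.verts G.verts := hφ.symm hinv.symm
  refine hG _ (he.of_bijOn hbij ?_ ?_)
  · intro u hu v hv
    rw [← hadj _ (hbij.mapsTo hu) _ (hbij.mapsTo hv), hinv.2 hu, hinv.2 hv]
  · intro v hv
    rw [← hwt _ (hbij.mapsTo hv), hinv.2 hv]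

theorem MinModel.exists_of_iso (h : MinModel G K) (hGH : G.Iso H) :
    ∃ L, MinModel H L ∧ K.Iso L := by
  induction h generalizing H with
  | of_minimal hG => exact ⟨H, .of_minimal (hGH.minimal hG), hGH⟩
  | contract he _ ih =>
    obtain ⟨φ, hφ, hadj, hwt⟩ := hGH
    obtain ⟨L, hL, hKL⟩ := ih (Iso.contract he.mem hφ hadj hwt)
    exact ⟨L, .contract (he.of_bijOn hφ hadj hwt) hL, hKL⟩

/-- If every contractible vertex of `G` is adjacent to a fixed vertex of nonnegative weight and
degree at most `2`, then `G` is strictly equivalent to all its minimal models. -/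
theorem MinModel.strictEquiv_of_forall_adj (h : MinModel G K) (hw : 0 ≤ G.wt z)
    (hd : G.deg z ≤ 2) (hadj : ∀ c, G.Contractible c → G.adj c z = true) :
    StrictEquiv K G := by
  induction h with
  | of_minimal => exact .refl _
  | @contract G K e he _ ih =>
    have hez := hadj e he
    refine .trans _ _ _ (ih ?_ ?_ ?_) (strictEquiv_contract he hez hd)
    · rw [contract_wt]; grind
    · rw [deg_le_two_iff] at hd ⊢
      rw [contractible_iff] at he
      have hsymm := G.symm
      intro a b c
      simp only [contract_adj]
      grind
    · intro c hc
      have hsymm := G.symm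
      have hirr := G.irrefl
      have hce := (mem_contract.1 hc.mem).1
      by_cases hec : G.adj e c = true
      · rw [contract_adj]
        have h₁ : c ≠ z := by
          rintro rfl
          have := (contractible_iff.1 hc).2.1
          rw [contract_wt] at this
          grind
        grind
      · have hc' : G.Contractible c := by
          rw [contractible_iff] at hc ⊢
          simp only [contract_adj, contract_wt, mem_contract] at hc
          grind
        have := hadj c hc'
        rw [contract_adj]
        grind

/-! ### Commuting contractions -/

theorem contract_comm (hfg : f ≠ g) (h : ¬ G.adj f g = true) :
    (G.contract f).contract g = (G.contract g).contract f := by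
  have hsymm := G.symm
  have hirr := G.irrefl
  have hadj : ((G.contract f).contract g).adj = ((G.contract g).contract f).adj := by
    funext a b
    rw [Bool.eq_iff_iff]
    simp only [contract_adj]
    grind
  have hwt : ((G.contract f).contract g).wt = ((G.contract g).contract f).wt := by
    funext a
    simp only [contract_adj, contract_wt]
    grind
  have hV : ((G.contract f).contract g).verts = ((G.contract g).contract f).verts :=
    Finset.erase_right_comm
  generalize (G.contract f).contract g = A at *
  generalize (G.contract g).contract f = B at *
  cases A
  cases B
  simp_all

theorem Contractible.contract (hg : G.Contractible g) (hfg : f ≠ g)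
    (h : ¬ G.adj f g = true)
    (hn : ∀ a b, G.adj g a = true → G.adj g b = true → G.adj f a = true → G.adj f b = true →
      a = b) : (G.contract f).Contractible g := by
  have hsymm := G.symm
  rw [contractible_iff] at hg ⊢
  simp only [contract_adj, contract_wt, mem_contract]
  grind

theorem iso_contract_of_adj_iff (hf : G.Contractible f) (hg : G.Contractible g)
    (h : ∀ a, G.adj f a = true ↔ G.adj g a = true) :
    (G.contract f).Iso (G.contract g) := by
  have hsymm := G.symm
  have hirr := G.irrefl
  have hswap : Equiv.swap f g f = g := Equiv.swap_apply_left f g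
  rw [← hswap]
  have hmf := hf.mem
  have hmg := hg.mem
  have hwf := hf.2.1
  have hwg := hg.2.1
  refine Iso.contract hf.mem ⟨?_, (Equiv.injective _).injOn, ?_⟩ ?_ ?_
  · intro a ha
    simp only [Finset.mem_coe, Equiv.swap_apply_def] at ha ⊢
    grind
  · intro a ha
    refine ⟨Equiv.swap f g a, ?_, Equiv.swap_apply_self _ _ _⟩
    simp only [Finset.mem_coe, Equiv.swap_apply_def] at ha ⊢
    grind
  · intro a ha b hb
    rw [Bool.eq_iff_iff]
    simp only [Equiv.swap_apply_def]
    grind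
  · intro a ha
    simp only [Equiv.swap_apply_def]
    grind

/-- All minimal models of `G` are strictly equivalent. -/
def UniqueMinModel (G : WGraph) : Prop :=
  ∀ K L, MinModel G K → MinModel G L → StrictEquiv K L

theorem strictEquiv_of_contract_of_not_adj
    (hu : ∀ e, G.Contractible e → (G.contract e).UniqueMinModel)
    (hf : G.Contractible f) (hg : G.Contractible g) (h : ¬ G.adj f g = true) {L : WGraph}
    (hK : MinModel (G.contract f) K) (hL : MinModel (G.contract g) L) : StrictEquiv K L := by
  by_cases hfg : f = g
  · subst hfg
    exact hu f hf _ _ hK hL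
  have hsymm := G.symm
  by_cases hn : ∀ a b, G.adj g a = true → G.adj g b = true → G.adj f a = true →
      G.adj f b = true → a = b
  · have hg' := hg.contract hfg h hn
    have hf' := hf.contract (Ne.symm hfg) (by grind) (by grind)
    obtain ⟨M, hM⟩ := exists_minModel ((G.contract f).contract g)
    refine .trans _ M _ (hu f hf _ _ hK (.contract hg' hM)) (hu g hg _ _ (.contract hf' ?_) hL)
    rwa [← contract_comm hfg h]
  · have hiso : (G.contract f).Iso (G.contract g) := by
      refine iso_contract_of_adj_iff hf hg ?_
      rw [contractible_iff] at hf hg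
      push Not at hn
      obtain ⟨a, b, hga, hgb, hfa, hfb, hab⟩ := hn
      intro c
      have := hf.2.2.1 a b c hfa hfb
      have := hg.2.2.1 a b c hga hgb
      grind
    obtain ⟨M, hM, hKM⟩ := hK.exists_of_iso hiso
    exact .trans _ _ _ hKM.strictEquiv (hu g hg _ _ hM hL)

theorem MinModel.strictEquiv_of_contract_adj (hf : G.Contractible f) (hg : G.Contractible g)
    (hfg : G.adj f g = true)
    (h : ∀ e, G.Contractible e → G.adj e f = true ∨ G.adj e g = true)
    (hK : MinModel (G.contract f) K) : StrictEquiv K G := by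
  have hsymm := G.symm
  have hirr := G.irrefl
  refine .trans _ _ _ (hK.strictEquiv_of_forall_adj (z := g) ?_ ?_ ?_)
    (strictEquiv_contract hf hfg hg.2.2.1)
  · rw [contract_wt, if_pos hfg, hg.2.1]
    norm_num
  · rw [contractible_iff] at hf hg
    rw [deg_le_two_iff]
    simp only [contract_adj]
    grind
  · intro c hc
    rw [contract_adj]
    have hcg : c ≠ g := by
      rintro rfl
      have := hc.2.1
      rw [contract_wt, if_pos hfg, hg.2.1] at this
      norm_num at this
    have hcf := (mem_contract.1 hc.mem).1
    by_cases hfc : G.adj f c = true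
    · grind
    · have hc' : G.Contractible c := by
        rw [contractible_iff] at hc ⊢
        simp only [contract_adj, contract_wt, mem_contract] at hc
        grind
      grind

theorem uniqueMinModel (G : WGraph) : G.UniqueMinModel := by
  intro K L hK hL
  have hu : ∀ e, G.Contractible e → (G.contract e).UniqueMinModel := fun e he =>
    have := card_contract_lt he.mem
    uniqueMinModel (G.contract e)
  cases hK with
  | of_minimal hG => rw [hL.eq_of_minimal hG]; exact .refl _
  | @contract _ _ f hf hK =>
  cases hL with
  | of_minimal hG => exact absurd hf (hG f)
  | @contract _ _ g hg hL =>
  have hsymm := G.symm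
  by_cases hfg : G.adj f g = true
  · by_cases h : ∀ e, G.Contractible e → G.adj e f = true ∨ G.adj e g = true
    · exact .trans _ _ _ (hK.strictEquiv_of_contract_adj hf hg hfg h)
        (.symm _ _ (hL.strictEquiv_of_contract_adj hg hf (hsymm f g ▸ hfg)
          fun e he => (h e he).symm))
    · push Not at h
      obtain ⟨e, he, hef, heg⟩ := h
      obtain ⟨M, hM⟩ := exists_minModel (G.contract e)
      exact .trans _ M _
        (strictEquiv_of_contract_of_not_adj hu hf he (by rwa [hsymm f e]) hK hM)
        (strictEquiv_of_contract_of_not_adj hu he hg heg hM hL)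
  · exact strictEquiv_of_contract_of_not_adj hu hf hg hfg hK hL
termination_by G.verts.card

theorem strictEquiv_of_wEquiv (h : WEquiv G H) :
    ∀ K L, MinModel G K → MinModel H L → StrictEquiv K L := by
  induction h with
  | rel G H h =>
    intro K L hK hL
    rcases h with h | h
    · obtain ⟨e, he, hiso⟩ := exists_contractible_of_wBlowup h
      obtain ⟨M, hM, hKM⟩ := hK.exists_of_iso hiso
      exact .trans _ _ _ hKM.strictEquiv (uniqueMinModel H _ _ (.contract he hM) hL)
    · obtain ⟨M, hM, hKM⟩ := hK.exists_of_iso h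
      exact .trans _ _ _ hKM.strictEquiv (uniqueMinModel H _ _ hM hL)
  | refl G => exact uniqueMinModel G
  | symm _ _ _ ih => exact fun K L hK hL => .symm _ _ (ih L K hL hK)
  | trans _ G _ _ _ ih₁ ih₂ =>
    intro K L hK hL
    obtain ⟨M, hM⟩ := exists_minModel G
    exact .trans _ _ _ (ih₁ K M hK hM) (ih₂ M L hM hL)

end WGraph

/-- **Theorem.** For minimal weighted graphs, equivalence implies strict
equivalence. -/
theorem minimal_equiv_implies_strictEquiv (G G' : WGraph)
    (hG : G.Minimal) (hG' : G'.Minimal) (h : WEquiv G G') :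
    StrictEquiv G G' := by
  exact WGraph.strictEquiv_of_wEquiv h G G' (.of_minimal hG) (.of_minimal hG')
end

section
/- If ℒ and ℒ' are equivalent linear chains, then there exists a finite sequence of blowings-up and blowings-down transforming ℒ into ℒ' in which every weighted graph occurring in the sequence is itself a linear chain. -/
namespace WGraph

theorem Iso.refl (G : WGraph) : G.Iso G :=
  ⟨id, Set.bijOn_id _, fun _ _ _ _ => rfl, fun _ _ => rfl⟩

theorem Iso.symm {G G' : WGraph} (h : G.Iso G') : G'.Iso G := by
  obtain ⟨f, hf, hadj, hwt⟩ := h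
  have hinv := hf.invOn_invFunOn
  have hmaps : Set.BijOn (Function.invFunOn f ↑G.verts) ↑G'.verts ↑G.verts :=
    (Set.bijOn_comm hinv.symm).1 hf
  refine ⟨Function.invFunOn f ↑G.verts, hmaps, fun u hu v hv => ?_, fun v hv => ?_⟩
  · rw [← hadj _ (hmaps.mapsTo hu) _ (hmaps.mapsTo hv), hinv.2 hu, hinv.2 hv]
  · rw [← hwt _ (hmaps.mapsTo hv), hinv.2 hv]

/-- Sum of the values of `g` over the neighbours of `v`. -/
def nbSum {A : Type*} [AddCommGroup A] (G : WGraph) (g : ℕ → A) (v : ℕ) : A :=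
  ∑ u ∈ G.verts, if G.adj v u = true then g u else 0

/-- The intersection matrix of `G` applied to `g`. -/
def lap {A : Type*} [AddCommGroup A] (G : WGraph) (g : ℕ → A) (v : ℕ) : A :=
  G.wt v • g v + G.nbSum g v

/-- The quadratic form given by the intersection matrix of `G`. -/
def quad (G : WGraph) (y : ℕ → ℚ) : ℚ := ∑ v ∈ G.verts, y v * G.lap y v

/-- `g` induces a homomorphism on the cokernel of the intersection matrix. -/
def IsLabeling {A : Type*} [AddCommGroup A] (G : WGraph) (g : ℕ → A) : Prop :=
  ∀ v ∈ G.verts, G.lap g v = 0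

/-- The sum of `F ∘ g` over the vertices, weighted by `deg v - 2`. -/
def charge {A : Type*} (G : WGraph) (g : ℕ → A) (F : A → ℤ) : ℤ :=
  ∑ v ∈ G.verts, (G.nbSum (fun _ => (1 : ℤ)) v - 2) * F (g v)

/-- The quadratic form of `G` is positive definite on some `k`-dimensional space. -/
def HasPosRank (G : WGraph) (k : ℕ) : Prop :=
  ∃ f : (Fin k → ℚ) →ₗ[ℚ] (ℕ → ℚ), ∀ x, x ≠ 0 → 0 < G.quad (f x)

/-- Every labeling of `G` comes with a labeling of `G'` of the same charge. -/
def LabelingLE (G G' : WGraph) : Prop :=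
  ∀ (A : Type) [AddCommGroup A] (g : ℕ → A), G.IsLabeling g →
    ∃ g' : ℕ → A, G'.IsLabeling g' ∧ ∀ F : A → ℤ, F 0 = 0 → G.charge g F = G'.charge g' F

theorem LabelingLE.trans {G₁ G₂ G₃ : WGraph} (h : G₁.LabelingLE G₂) (h' : G₂.LabelingLE G₃) :
    G₁.LabelingLE G₃ := by
  intro A _ g hg
  obtain ⟨g', hg', hF⟩ := h A g hg
  obtain ⟨g'', hg'', hF'⟩ := h' A g' hg'
  exact ⟨g'', hg'', fun F h0 => (hF F h0).trans (hF' F h0)⟩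

theorem nbSum_congr {A : Type*} [AddCommGroup A] {G : WGraph} {g g' : ℕ → A}
    (h : ∀ v ∈ G.verts, g v = g' v) (v : ℕ) : G.nbSum g v = G.nbSum g' v :=
  Finset.sum_congr rfl fun u hu => by rw [h u hu]

theorem lap_congr {A : Type*} [AddCommGroup A] {G : WGraph} {g g' : ℕ → A}
    (h : ∀ v ∈ G.verts, g v = g' v) {v : ℕ} (hv : v ∈ G.verts) : G.lap g v = G.lap g' v := by
  rw [lap, lap, h v hv, nbSum_congr h]

theorem quad_congr {G : WGraph} {y y' : ℕ → ℚ} (h : ∀ v ∈ G.verts, y v = y' v) :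
    G.quad y = G.quad y' :=
  Finset.sum_congr rfl fun v hv => by rw [h v hv, lap_congr h hv]

theorem charge_congr {A : Type*} {G : WGraph} {g g' : ℕ → A} (h : ∀ v ∈ G.verts, g v = g' v)
    (F : A → ℤ) : G.charge g F = G.charge g' F :=
  Finset.sum_congr rfl fun v hv => by rw [h v hv]

/-! ### Invariance under isomorphism -/

section Iso

variable {G G' : WGraph} {f : ℕ → ℕ}

theorem sum_verts_eq_of_bijOn {A : Type*} [AddCommGroup A]
    (hf : Set.BijOn f ↑G.verts ↑G'.verts) (F : ℕ → A) :
    ∑ v ∈ G'.verts, F v = ∑ v ∈ G.verts, F (f v) := by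
  have : G'.verts = G.verts.image f := by
    apply Finset.coe_injective
    rw [Finset.coe_image, hf.image_eq]
  rw [this, Finset.sum_image hf.injOn]

theorem nbSum_comp {A : Type*} [AddCommGroup A] (hf : Set.BijOn f ↑G.verts ↑G'.verts)
    (hadj : ∀ u ∈ G.verts, ∀ v ∈ G.verts, G'.adj (f u) (f v) = G.adj u v)
    (g : ℕ → A) {v : ℕ} (hv : v ∈ G.verts) : G'.nbSum g (f v) = G.nbSum (g ∘ f) v := by
  rw [nbSum, sum_verts_eq_of_bijOn hf]
  exact Finset.sum_congr rfl fun u hu => by rw [hadj v hv u hu]; rfl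

theorem lap_comp {A : Type*} [AddCommGroup A] (hf : Set.BijOn f ↑G.verts ↑G'.verts)
    (hadj : ∀ u ∈ G.verts, ∀ v ∈ G.verts, G'.adj (f u) (f v) = G.adj u v)
    (hwt : ∀ v ∈ G.verts, G'.wt (f v) = G.wt v)
    (g : ℕ → A) {v : ℕ} (hv : v ∈ G.verts) : G'.lap g (f v) = G.lap (g ∘ f) v := by
  rw [lap, lap, nbSum_comp hf hadj g hv, hwt v hv]; rfl

theorem Iso.labelingLE (h : G'.Iso G) : G.LabelingLE G' := by
  obtain ⟨f, hf, hadj, hwt⟩ := h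
  intro A _ g hg
  refine ⟨g ∘ f, fun v hv => ?_, fun F _ => ?_⟩
  · rw [← lap_comp hf hadj hwt g hv]
    exact hg _ (hf.mapsTo hv)
  · rw [charge, sum_verts_eq_of_bijOn hf]
    refine Finset.sum_congr rfl fun v hv => ?_
    rw [nbSum_comp hf hadj _ hv]; rfl

theorem Iso.hasPosRank (h : G'.Iso G) {k : ℕ} (hk : G.HasPosRank k) : G'.HasPosRank k := by
  obtain ⟨f, hf, hadj, hwt⟩ := h
  obtain ⟨φ, hφ⟩ := hk
  refine ⟨(LinearMap.funLeft ℚ ℚ f).comp φ, fun x hx => ?_⟩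
  have key : G'.quad (φ x ∘ f) = G.quad (φ x) := by
    rw [quad, quad, sum_verts_eq_of_bijOn hf]
    exact Finset.sum_congr rfl fun v hv => by rw [lap_comp hf hadj hwt _ hv]; rfl
  exact (hφ x hx).trans_eq key.symm

end Iso

/-! ### Invariance under blowing-up -/

/-- The three kinds of blowing-up, seen as blowing-up a clique `S` with at most two vertices. -/
structure IsCliqueBlowup (G G' : WGraph) (S : Finset ℕ) (e : ℕ) : Prop where
  notMem : e ∉ G.verts
  subset : S ⊆ G.verts
  card_le : S.card ≤ 2
  clique : ∀ a ∈ S, ∀ b ∈ S, a ≠ b → G.adj a b = true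
  verts_eq : G'.verts = insert e G.verts
  adj_old : ∀ a ∈ G.verts, ∀ b ∈ G.verts,
    (G'.adj a b = true ↔ G.adj a b = true ∧ ¬(a ∈ S ∧ b ∈ S))
  adj_new : ∀ b ∈ G.verts, (G'.adj e b = true ↔ b ∈ S)
  wt_new : G'.wt e = -1
  wt_old : ∀ a ∈ G.verts, G'.wt a = G.wt a - if a ∈ S then 1 else 0

theorem _root_.WBlowup.exists_isCliqueBlowup {G G' : WGraph} (h : WBlowup G G') :
    ∃ S e, G.IsCliqueBlowup G' S e := by
  rcases h with ⟨v, e, hv, he, hV, hadj, hwe, hwv, hw⟩ |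
    ⟨v₁, v₂, e, h12, he, hV, hadj, hwe, hw1, hw2, hw⟩ | ⟨e, he, hV, hadj, hwe, hw⟩
  · refine ⟨{v}, e, he, by simpa using hv, by simp, ?_, hV, ?_, ?_, hwe, ?_⟩
    · intro a ha b hb hab
      simp only [Finset.mem_singleton] at ha hb
      exact absurd (ha.trans hb.symm) hab
    · intro a ha b hb
      have hae : a ≠ e := fun h => he (h ▸ ha)
      have hbe : b ≠ e := fun h => he (h ▸ hb)
      rw [hadj]
      simp only [hae, hbe, false_and, and_false, or_false, Finset.mem_singleton]
      refine ⟨fun h => ⟨h, ?_⟩, fun h => h.1⟩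
      rintro ⟨rfl, rfl⟩
      simp [G.irrefl] at h
    · intro b hb
      have hbe : b ≠ e := fun h => he (h ▸ hb)
      have hn : ¬ G.adj e b = true := fun h => he (G.adj_mem _ _ h).1
      rw [hadj]
      simp [hn, hbe]
    · intro a ha
      by_cases hav : a = v
      · subst hav; simp [hwv]
      · simp [hav, hw a ha hav]
  · have hm := G.adj_mem _ _ h12
    have h21 : G.adj v₂ v₁ = true := (G.symm _ _).trans h12
    refine ⟨{v₁, v₂}, e, he, ?_, Finset.card_le_two, ?_, hV, ?_, ?_, hwe, ?_⟩
    · intro a ha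
      simp only [Finset.mem_insert, Finset.mem_singleton] at ha
      rcases ha with rfl | rfl
      exacts [hm.1, hm.2]
    · intro a ha b hb hab
      simp only [Finset.mem_insert, Finset.mem_singleton] at ha hb
      rcases ha with rfl | rfl <;> rcases hb with rfl | rfl <;> first | assumption | simp at hab
    · intro a ha b hb
      have hae : a ≠ e := fun h => he (h ▸ ha)
      have hbe : b ≠ e := fun h => he (h ▸ hb)
      rw [hadj]
      simp only [hae, hbe, false_and, or_false, Finset.mem_singleton, Finset.mem_insert]
      constructor
      · rintro ⟨h, h1, h2⟩
        refine ⟨h, ?_⟩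
        rintro ⟨rfl | rfl, rfl | rfl⟩ <;> simp_all [G.irrefl]
      · rintro ⟨h, h1⟩
        exact ⟨h, by tauto, by tauto⟩
    · intro b hb
      have hbe : b ≠ e := fun h => he (h ▸ hb)
      have hn : ¬ G.adj e b = true := fun h => he (G.adj_mem _ _ h).1
      rw [hadj]
      simp [hn, hbe]
    · intro a ha
      by_cases ha1 : a = v₁
      · subst ha1; simp [hw1]
      · by_cases ha2 : a = v₂
        · subst ha2; simp [hw2]
        · simp [ha1, ha2, hw a ha ha1 ha2]
  · refine ⟨∅, e, he, by simp, by simp, by simp, hV, ?_, ?_, hwe, ?_⟩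
    · intro a _ b _
      simp [hadj]
    · intro b hb
      have hn : ¬ G.adj e b = true := fun h => he (G.adj_mem _ _ h).1
      simpa [hadj] using hn
    · intro a ha
      simp [hw a ha]

namespace IsCliqueBlowup

variable {G G' : WGraph} {S : Finset ℕ} {e : ℕ} {A : Type*} [AddCommGroup A]

theorem nbSum_new (h : G.IsCliqueBlowup G' S e) (g : ℕ → A) :
    G'.nbSum g e = ∑ a ∈ S, g a := by
  rw [nbSum, h.verts_eq, Finset.sum_insert h.notMem, G'.irrefl]
  simp only [Bool.false_eq_true, if_false, zero_add]
  rw [Finset.sum_congr rfl fun u hu => by rw [if_congr (h.adj_new u hu) rfl rfl],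
    ← Finset.sum_filter, Finset.filter_mem_eq_inter, Finset.inter_eq_right.2 h.subset]

theorem nbSum_old (h : G.IsCliqueBlowup G' S e) (g : ℕ → A) {a : ℕ} (ha : a ∈ G.verts) :
    G'.nbSum g a = G.nbSum g a + if a ∈ S then g e + g a - ∑ b ∈ S, g b else 0 := by
  have hae : G'.adj a e = true ↔ a ∈ S := by rw [G'.symm]; exact h.adj_new a ha
  rw [nbSum, h.verts_eq, Finset.sum_insert h.notMem, if_congr hae rfl rfl,
    Finset.sum_congr rfl fun u hu => by rw [if_congr (h.adj_old a ha u hu) rfl rfl]]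
  by_cases hS : a ∈ S
  · have hsplit : G.nbSum g a = (∑ u ∈ G.verts,
        if G.adj a u = true ∧ ¬(a ∈ S ∧ u ∈ S) then g u else 0) + ∑ u ∈ S.erase a, g u := by
      have : S.erase a = G.verts.filter (fun u => u ∈ S.erase a) := by
        rw [Finset.filter_mem_eq_inter, Finset.inter_eq_right.2]
        exact (Finset.erase_subset _ _).trans h.subset
      rw [this, Finset.sum_filter, ← Finset.sum_add_distrib, nbSum]
      refine Finset.sum_congr rfl fun u _ => ?_
      by_cases hu : u ∈ S
      · by_cases hua : u = a
        · subst hua; simp [G.irrefl]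
        · simp [hu, hS, hua, h.clique a hS u hu (Ne.symm hua)]
      · simp [hu]
    rw [hsplit, if_pos hS, if_pos hS, ← Finset.sum_erase_add _ _ hS]
    abel
  · simp [hS, nbSum]

theorem lap_new (h : G.IsCliqueBlowup G' S e) (g : ℕ → A) :
    G'.lap g e = (∑ a ∈ S, g a) - g e := by
  rw [lap, h.nbSum_new, h.wt_new]; simp; abel

theorem lap_old (h : G.IsCliqueBlowup G' S e) (g : ℕ → A) {a : ℕ} (ha : a ∈ G.verts) :
    G'.lap g a = G.lap g a + if a ∈ S then g e - ∑ b ∈ S, g b else 0 := by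
  rw [lap, lap, h.nbSum_old g ha, h.wt_old a ha]
  split_ifs
  · rw [sub_smul, one_smul]; abel
  · simp

theorem quad_eq (h : G.IsCliqueBlowup G' S e) (y : ℕ → ℚ) :
    G'.quad y = G.quad y - (y e - ∑ a ∈ S, y a) ^ 2 := by
  have h1 : ∑ v ∈ G.verts, y v * G'.lap y v =
      G.quad y + (∑ a ∈ S, y a) * (y e - ∑ a ∈ S, y a) := by
    have : S = G.verts.filter (fun u => u ∈ S) := by
      rw [Finset.filter_mem_eq_inter, Finset.inter_eq_right.2 h.subset]
    rw [Finset.sum_mul]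
    conv_rhs => rw [this]
    rw [Finset.sum_filter, quad, ← Finset.sum_add_distrib]
    refine Finset.sum_congr rfl fun v hv => ?_
    rw [h.lap_old y hv, ← this]
    split_ifs <;> ring
  rw [quad, h.verts_eq, Finset.sum_insert h.notMem, h1, h.lap_new]
  ring

theorem isLabeling_iff (h : G.IsCliqueBlowup G' S e) (g : ℕ → A) :
    G'.IsLabeling g ↔ G.IsLabeling g ∧ g e = ∑ a ∈ S, g a := by
  have hiff : G'.IsLabeling g ↔ G'.lap g e = 0 ∧ ∀ v ∈ G.verts, G'.lap g v = 0 := by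
    rw [IsLabeling, h.verts_eq, Finset.forall_mem_insert]
  rw [hiff, h.lap_new, sub_eq_zero, and_comm, eq_comm (b := g e)]
  refine and_congr_left fun he => forall₂_congr fun v hv => ?_
  rw [h.lap_old g hv, he]
  simp

theorem charge_eq (h : G.IsCliqueBlowup G' S e) {g : ℕ → A} (hg : g e = ∑ a ∈ S, g a)
    {F : A → ℤ} (hF : F 0 = 0) : G'.charge g F = G.charge g F := by
  have h1 : ∑ v ∈ G.verts, (G'.nbSum (fun _ => (1 : ℤ)) v - 2) * F (g v) =
      G.charge g F + (2 - S.card) * ∑ a ∈ S, F (g a) := by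
    have : S = G.verts.filter (fun u => u ∈ S) := by
      rw [Finset.filter_mem_eq_inter, Finset.inter_eq_right.2 h.subset]
    rw [Finset.mul_sum]
    conv_rhs => rw [this]
    rw [Finset.sum_filter, charge, ← Finset.sum_add_distrib]
    refine Finset.sum_congr rfl fun v hv => ?_
    rw [h.nbSum_old _ hv, ← this]
    split_ifs
    · simp; ring
    · simp
  rw [charge, h.verts_eq, Finset.sum_insert h.notMem, h1, h.nbSum_new, hg]
  have hcard := h.card_le
  interval_cases hc : S.card
  · rw [Finset.card_eq_zero.1 hc]; simp [hF]
  · obtain ⟨a, rfl⟩ := Finset.card_eq_one.1 hc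
    simp
  · simp [hc]

theorem labelingLE (h : G.IsCliqueBlowup G' S e) : G.LabelingLE G' := by
  intro A _ g hg
  have hagree : ∀ v ∈ G.verts, g v = Function.update g e (∑ a ∈ S, g a) v := fun v hv =>
    (Function.update_of_ne (ne_of_mem_of_not_mem hv h.notMem) _ _).symm
  have he : Function.update g e (∑ a ∈ S, g a) e =
      ∑ a ∈ S, Function.update g e (∑ a ∈ S, g a) a := by
    rw [Function.update_self]
    exact Finset.sum_congr rfl fun a ha => hagree a (h.subset ha)
  refine ⟨_, (h.isLabeling_iff _).2 ⟨fun v hv => ?_, he⟩, fun F hF => ?_⟩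
  · rw [← lap_congr hagree hv, hg v hv]
  · rw [h.charge_eq he hF, charge_congr hagree]

theorem labelingLE' (h : G.IsCliqueBlowup G' S e) : G'.LabelingLE G := by
  intro A _ g hg
  have := (h.isLabeling_iff g).1 hg
  exact ⟨g, this.1, fun F hF => h.charge_eq this.2 hF⟩

theorem hasPosRank_iff (h : G.IsCliqueBlowup G' S e) (k : ℕ) :
    G.HasPosRank k ↔ G'.HasPosRank k := by
  constructor
  · rintro ⟨φ, hφ⟩
    let extend : (ℕ → ℚ) →ₗ[ℚ] (ℕ → ℚ) :=
      { toFun := fun y => Function.update y e (∑ a ∈ S, y a)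
        map_add' := fun y z => by
          rw [← Function.update_add]; simp [Finset.sum_add_distrib]
        map_smul' := fun c y => by
          rw [RingHom.id_apply, ← Function.update_smul]; simp [Finset.mul_sum] }
    refine ⟨extend.comp φ, fun x hx => ?_⟩
    have hagree : ∀ v ∈ G.verts, φ x v = extend (φ x) v := fun v hv =>
      (Function.update_of_ne (ne_of_mem_of_not_mem hv h.notMem) (∑ a ∈ S, φ x a) (φ x)).symm
    have he : extend (φ x) e = ∑ a ∈ S, extend (φ x) a := by
      change Function.update (φ x) e (∑ a ∈ S, φ x a) e = _
      rw [Function.update_self]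
      exact Finset.sum_congr rfl fun a ha => hagree a (h.subset ha)
    rw [LinearMap.comp_apply, h.quad_eq, he, ← quad_congr hagree]
    simpa using hφ x hx
  · rintro ⟨φ, hφ⟩
    refine ⟨φ, fun x hx => ?_⟩
    have := hφ x hx
    rw [h.quad_eq] at this
    linarith [sq_nonneg (φ x e - ∑ a ∈ S, φ x a)]

end IsCliqueBlowup

end WGraph

theorem WEquiv.labelingLE {G G' : WGraph} (h : WEquiv G G') :
    G.LabelingLE G' ∧ G'.LabelingLE G := by
  induction h with
  | rel G G' h =>
    rcases h with h | h
    · obtain ⟨S, e, h⟩ := h.exists_isCliqueBlowup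
      exact ⟨h.labelingLE, h.labelingLE'⟩
    · exact ⟨h.symm.labelingLE, h.labelingLE⟩
  | refl G => exact ⟨(WGraph.Iso.refl G).labelingLE, (WGraph.Iso.refl G).labelingLE⟩
  | symm _ _ _ ih => exact ih.symm
  | trans _ _ _ _ _ ih ih' => exact ⟨ih.1.trans ih'.1, ih'.2.trans ih.2⟩

theorem WEquiv.hasPosRank_iff {G G' : WGraph} (h : WEquiv G G') (k : ℕ) :
    G.HasPosRank k ↔ G'.HasPosRank k := by
  induction h with
  | rel G G' h =>
    rcases h with h | h
    · obtain ⟨S, e, h⟩ := h.exists_isCliqueBlowup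
      exact h.hasPosRank_iff k
    · exact ⟨h.symm.hasPosRank, h.hasPosRank⟩
  | refl G => exact Iff.rfl
  | symm _ _ _ ih => exact ih.symm
  | trans _ _ _ _ _ ih ih' => exact ih.trans ih'

/-! ### Linear chains: the intersection matrix -/

section Chain

variable {A : Type*} [AddCommGroup A]

theorem chainGraph_verts (X : List ℤ) : (chainGraph X).verts = Finset.range X.length := rfl

theorem chainGraph_adj_iff (X : List ℤ) (i j : ℕ) : (chainGraph X).adj i j = true ↔
    i < X.length ∧ j < X.length ∧ (i + 1 = j ∨ j + 1 = i) := by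
  simp [chainGraph]

theorem chainGraph_wt (X : List ℤ) (i : ℕ) : (chainGraph X).wt i = X[i]?.getD 0 := by
  by_cases h : i < X.length <;> simp [chainGraph, h]

theorem nbSum_chainGraph (X : List ℤ) (g : ℕ → A) {i : ℕ} (hi : i < X.length) :
    (chainGraph X).nbSum g i =
      (if 0 < i then g (i - 1) else 0) + if i + 1 < X.length then g (i + 1) else 0 := by
  have hsplit : ∀ u ∈ Finset.range X.length, (if (chainGraph X).adj i u = true then g u else 0) =
      (if u = i - 1 then (if 0 < i then g u else 0) else 0) + if u = i + 1 then g u else 0 := by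
    intro u hu
    rw [Finset.mem_range] at hu
    have := chainGraph_adj_iff X i u
    by_cases h1 : u + 1 = i
    · subst h1
      have : u ≠ u + 1 + 1 := by omega
      simp [chainGraph_adj_iff, hi, hu, this]
    · by_cases h2 : i + 1 = u
      · subst h2; simp [this, hi, hu]; omega
      · have : ¬ (chainGraph X).adj i u = true := by rw [this]; omega
        rw [if_neg this]
        split_ifs <;> first | omega | simp
  rw [WGraph.nbSum, chainGraph_verts, Finset.sum_congr rfl hsplit, Finset.sum_add_distrib,
    Finset.sum_ite_eq', Finset.sum_ite_eq']
  have : i - 1 < X.length := by omega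
  simp [this]

theorem charge_chainGraph {A : Type*} (X : List ℤ) (g : ℕ → A) (F : A → ℤ) (hX : X ≠ []) :
    (chainGraph X).charge g F = -(F (g 0) + F (g (X.length - 1))) := by
  have hpos : 0 < X.length := List.length_pos_of_ne_nil hX
  have hsplit : ∀ i ∈ Finset.range X.length,
      ((chainGraph X).nbSum (fun _ => (1 : ℤ)) i - 2) * F (g i) =
        -(if i = 0 then F (g i) else 0) - if i = X.length - 1 then F (g i) else 0 := by
    intro i hi
    rw [Finset.mem_range] at hi
    rw [nbSum_chainGraph X _ hi]
    split_ifs <;> omega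
  rw [WGraph.charge, chainGraph_verts, Finset.sum_congr rfl hsplit, Finset.sum_sub_distrib,
    Finset.sum_neg_distrib, Finset.sum_ite_eq', Finset.sum_ite_eq']
  have : X.length - 1 < X.length := by omega
  simp [hpos, this]
  ring

/-- The quadratic form of a linear chain. -/
def chainQuad : List ℤ → (ℕ → ℚ) → ℚ
  | [], _ => 0
  | a :: X, y => a * y 0 ^ 2 + (if X = [] then 0 else 2 * y 0 * y 1) +
      chainQuad X (fun i => y (i + 1))

theorem quad_chainGraph (X : List ℤ) (y : ℕ → ℚ) : (chainGraph X).quad y = chainQuad X y := by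
  induction X generalizing y with
  | nil => simp [WGraph.quad, chainGraph, chainQuad]
  | cons a X ih =>
    have hshift : ∀ i ∈ Finset.range X.length, y (i + 1) * (chainGraph (a :: X)).lap y (i + 1) =
        y (i + 1) * (chainGraph X).lap (fun i => y (i + 1)) i +
          if i = 0 then y 1 * y 0 else 0 := by
      intro i hi
      rw [Finset.mem_range] at hi
      rw [WGraph.lap, WGraph.lap, nbSum_chainGraph X _ hi, nbSum_chainGraph (a :: X) _ (by simpa)]
      rcases i with _ | i
      · simp [chainGraph_wt]
        split_ifs <;> first | omega | ring
      · simp [chainGraph_wt]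
    rw [chainQuad, ← ih, WGraph.quad, chainGraph_verts, List.length_cons, Finset.sum_range_succ',
      Finset.sum_congr rfl hshift, Finset.sum_add_distrib, Finset.sum_ite_eq', WGraph.lap,
      nbSum_chainGraph (a :: X) _ (by simp), WGraph.quad, chainGraph_verts]
    rcases X with _ | ⟨b, X⟩ <;> simp [chainGraph_wt] <;> ring

/-- The continuants of `X` and of its tail, with signs: `(n, q)` such that the cokernel of the
intersection matrix is `ℤ/n`, the first vertex being `q` times the last one. -/
def chainFrac : List ℤ → ℤ × ℤ
  | [] => (1, 0)
  | x :: X => (-x * (chainFrac X).1 - (chainFrac X).2, (chainFrac X).1)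

theorem isLabeling_chainGraph_iff (X : List ℤ) (g : ℕ → A) :
    (chainGraph X).IsLabeling g ↔ ∃ t : A, (chainFrac X).1 • t = 0 ∧
      ∀ i < X.length, g i = (chainFrac (X.drop i)).2 • t := by
  have hlab : (chainGraph X).IsLabeling g ↔ ∀ i, (hi : i < X.length) → X[i] • g i +
      ((if 0 < i then g (i - 1) else 0) + if i + 1 < X.length then g (i + 1) else 0) = 0 := by
    simp only [WGraph.IsLabeling, chainGraph_verts, Finset.mem_range]
    refine forall₂_congr fun i hi => ?_
    rw [WGraph.lap, nbSum_chainGraph X g hi, chainGraph_wt]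
    simp [hi]
  have hfrac : ∀ i, (hi : i < X.length) → chainFrac (X.drop i) =
      (-X[i] * (chainFrac (X.drop (i + 1))).1 - (chainFrac (X.drop (i + 1))).2,
        (chainFrac (X.drop (i + 1))).1) := fun i hi => by
    rw [List.drop_eq_getElem_cons hi, chainFrac]
  rw [hlab]
  constructor
  · intro h
    let H : ℕ → A := fun i => if 0 < i ∧ i ≤ X.length then g (i - 1) else 0
    have hH : ∀ i, (hi : i < X.length) → H i = -(X[i] • H (i + 1)) - H (i + 2) := by
      intro i hi
      have := h i hi
      have e0 : H i = if 0 < i then g (i - 1) else 0 := by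
        simp only [H]; congr 1; simp; omega
      have e1 : H (i + 1) = g i := by simp [H, hi]
      have e2 : H (i + 2) = if i + 1 < X.length then g (i + 1) else 0 := by
        simp only [H]; congr 1; simp; omega
      rw [← e0, ← e1, ← e2] at this
      exact eq_sub_of_add_eq (eq_neg_of_add_eq_zero_right this)
    have key : ∀ j i, i + j = X.length → H i = (chainFrac (X.drop i)).1 • H X.length ∧
        H (i + 1) = (chainFrac (X.drop i)).2 • H X.length := by
      intro j
      induction j with
      | zero =>
        intro i hi
        simp only [add_zero] at hi
        subst hi
        simp [chainFrac, H]
      | succ j ih =>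
        intro i hi
        have hlt : i < X.length := by omega
        obtain ⟨h1, h2⟩ := ih (i + 1) (by omega)
        rw [hfrac i hlt]
        refine ⟨?_, h1⟩
        rw [hH i hlt, h1, h2, sub_smul, mul_smul, neg_smul]
    refine ⟨H X.length, ?_, fun i hi => ?_⟩
    · have := (key X.length 0 (by simp)).1
      simpa [H] using this.symm
    · have := (key (X.length - i) i (by omega)).2
      simpa [H, hi] using this
  · rintro ⟨t, ht, hg⟩ i hi
    have e2 : (if i + 1 < X.length then g (i + 1) else 0) =
        (chainFrac (X.drop (i + 1))).2 • t := by
      split_ifs with h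
      · exact hg _ h
      · rw [List.drop_eq_nil_of_le (by omega)]; simp [chainFrac]
    have e0 : (if 0 < i then g (i - 1) else 0) = (chainFrac (X.drop i)).1 • t := by
      rcases i with _ | i
      · simpa using ht.symm
      · simp [hg i (by omega), hfrac i (by omega)]
    rw [e0, e2, hg i hi, hfrac i hi]
    simp only [← mul_smul, ← add_smul]
    convert zero_smul ℤ t
    ring

theorem charge_chainGraph_of_frac (X : List ℤ) (g : ℕ → A) (t : A)
    (ht : (chainFrac X).1 • t = 0)
    (hg : ∀ i < X.length, g i = (chainFrac (X.drop i)).2 • t) (F : A → ℤ) (hF : F 0 = 0) :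
    (chainGraph X).charge g F = -(F ((chainFrac X).2 • t) + F t) := by
  rcases eq_or_ne X [] with rfl | hX
  · have : t = 0 := by simpa [chainFrac] using ht
    simp [WGraph.charge, chainGraph, this, hF]
  · have hpos : 0 < X.length := List.length_pos_of_ne_nil hX
    rw [charge_chainGraph X g F hX, hg 0 hpos, hg _ (Nat.sub_lt hpos one_pos),
      List.drop_length_sub_one hX]
    simp [chainFrac]

theorem WEquiv.exists_chainFrac_smul {X Y : List ℤ} (h : WEquiv (chainGraph X) (chainGraph Y))
    {A : Type} [AddCommGroup A] {t : A} (ht : (chainFrac X).1 • t = 0) :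
    ∃ t' : A, (chainFrac Y).1 • t' = 0 ∧ ∀ F : A → ℤ, F 0 = 0 →
      F ((chainFrac X).2 • t) + F t = F ((chainFrac Y).2 • t') + F t' := by
  obtain ⟨g', hg', hF⟩ := h.labelingLE.1 A (fun i => (chainFrac (X.drop i)).2 • t)
    ((isLabeling_chainGraph_iff X _).2 ⟨t, ht, fun _ _ => rfl⟩)
  obtain ⟨t', ht', hgt'⟩ := (isLabeling_chainGraph_iff Y g').1 hg'
  refine ⟨t', ht', fun F h0 => ?_⟩
  have := hF F h0
  rw [charge_chainGraph_of_frac X _ t ht (fun _ _ => rfl) F h0,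
    charge_chainGraph_of_frac Y g' t' ht' hgt' F h0] at this
  exact neg_injective this

end Chain

/-! ### Moves between linear chains -/

/-- A blowing-up, a blowing-down or an isomorphism between two linear chains. -/
def IsChainStep (G G' : WGraph) : Prop :=
  IsLinearChain G ∧ IsLinearChain G' ∧ (WBlowup G G' ∨ WBlowup G' G ∨ WGraph.Iso G G')

/-- The equivalence of linear chains, on the level of sequences of weights. -/
inductive ChainEquiv : List ℤ → List ℤ → Prop
  | refl (X) : ChainEquiv X X
  | symm {X Y} : ChainEquiv X Y → ChainEquiv Y X
  | trans {X Y Z} : ChainEquiv X Y → ChainEquiv Y Z → ChainEquiv X Z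
  | reverse (X) : ChainEquiv X X.reverse
  | edge (X a b Y) : ChainEquiv (X ++ a :: b :: Y) (X ++ (a - 1) :: (-1) :: (b - 1) :: Y)
  | last (X a) : ChainEquiv (X ++ [a]) (X ++ [a - 1, -1])
  | nil : ChainEquiv [] [-1]

theorem isLinearChain_chainGraph (X : List ℤ) : IsLinearChain (chainGraph X) :=
  ⟨X, WGraph.Iso.refl _⟩

theorem IsChainStep.symm {G G' : WGraph} (h : IsChainStep G G') : IsChainStep G' G := by
  obtain ⟨h1, h2, h | h | h⟩ := h
  · exact ⟨h2, h1, Or.inr (Or.inl h)⟩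
  · exact ⟨h2, h1, Or.inl h⟩
  · exact ⟨h2, h1, Or.inr (Or.inr h.symm)⟩

theorem IsChainStep.wEquiv {G G' : WGraph} (h : IsChainStep G G') : WEquiv G G' := by
  obtain ⟨-, -, h | h | h⟩ := h
  · exact .rel _ _ (Or.inl h)
  · exact .symm _ _ (.rel _ _ (Or.inl h))
  · exact .rel _ _ (Or.inr h)

theorem iso_chainGraph_reverse (X : List ℤ) :
    (chainGraph X).Iso (chainGraph X.reverse) := by
  refine ⟨fun i => X.length - 1 - i, ⟨?_, ?_, ?_⟩, ?_, ?_⟩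
  · intro i
    simp only [chainGraph_verts, Finset.coe_range, Set.mem_Iio, List.length_reverse]
    omega
  · intro i hi j hj
    simp only [chainGraph_verts, Finset.coe_range, Set.mem_Iio] at *
    omega
  · intro i hi
    simp only [chainGraph_verts, Finset.coe_range, Set.mem_Iio, List.length_reverse] at *
    exact ⟨X.length - 1 - i, by simp only [Set.mem_Iio]; omega, by dsimp only; omega⟩
  · intro i hi j hj
    simp only [chainGraph_verts, Finset.mem_range] at hi hj
    rw [Bool.eq_iff_iff, chainGraph_adj_iff, chainGraph_adj_iff, List.length_reverse]
    dsimp only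
    omega
  · intro i hi
    simp only [chainGraph_verts, Finset.mem_range] at hi
    rw [chainGraph_wt, chainGraph_wt, List.getElem?_reverse (by dsimp only; omega)]
    congr 2
    dsimp only
    omega

/-- The pullback of the weighted graph `G` along `f`, with vertex set `V`. -/
def WGraph.comap (G : WGraph) (f : ℕ → ℕ) (V : Finset ℕ) : WGraph where
  verts := V
  adj := fun i j => decide (i ∈ V) && decide (j ∈ V) && G.adj (f i) (f j)
  symm := fun u v => by rw [G.symm, Bool.and_comm (decide (u ∈ V))]
  irrefl := fun v => by simp [G.irrefl]
  adj_mem := fun u v h => by simp at h; exact h.1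
  wt := fun i => G.wt (f i)

theorem WGraph.comap_iso {G : WGraph} {f : ℕ → ℕ} {V : Finset ℕ}
    (hf : Set.BijOn f ↑V ↑G.verts) : (G.comap f V).Iso G := by
  refine ⟨f, hf, fun u hu v hv => ?_, fun _ _ => rfl⟩
  have hu' : u ∈ V := hu
  have hv' : v ∈ V := hv
  simp [comap, hu', hv']

theorem exists_wBlowup_iso_chainGraph_edge (X : List ℤ) (a b : ℤ) (Y : List ℤ) :
    ∃ G', WBlowup (chainGraph (X ++ a :: b :: Y)) G' ∧
      G'.Iso (chainGraph (X ++ (a - 1) :: (-1) :: (b - 1) :: Y)) := by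
  let m := X.length + Y.length + 2
  let p := X.length
  let f : ℕ → ℕ := fun i => if i ≤ p then i else if i = m then p + 1 else i + 1
  have hm : m = X.length + Y.length + 2 := rfl
  have hp : p = X.length := rfl
  have hf : ∀ i, (i ≤ p ∧ f i = i) ∨ (p < i ∧ i = m ∧ f i = p + 1) ∨
      (p < i ∧ i ≠ m ∧ f i = i + 1) := by
    intro i
    simp only [f]
    split_ifs <;> omega
  have hbij : Set.BijOn f ↑(Finset.range (m + 1))
      ↑(chainGraph (X ++ (a - 1) :: (-1) :: (b - 1) :: Y)).verts := by
    simp only [chainGraph_verts, Finset.coe_range, List.length_append, List.length_cons]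
    refine ⟨?_, ?_, ?_⟩
    · intro i hi
      have := hf i
      simp only [Set.mem_Iio] at *
      omega
    · intro i hi j hj hij
      have := hf i
      have := hf j
      simp only [Set.mem_Iio] at *
      omega
    · intro j hj
      simp only [Set.mem_Iio] at hj
      refine ⟨if j ≤ p then j else if j = p + 1 then m else j - 1, ?_, ?_⟩
      · simp only [Set.mem_Iio]
        split_ifs <;> omega
      · split_ifs with h1 h2
        · have := hf j; omega
        · have := hf m; omega
        · have := hf (j - 1); omega
  refine ⟨(chainGraph (X ++ (a - 1) :: (-1) :: (b - 1) :: Y)).comap f (Finset.range (m + 1)),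
    Or.inr (Or.inl ⟨p, p + 1, m, ?_, ?_, ?_, ?_, ?_, ?_, ?_, ?_⟩), WGraph.comap_iso hbij⟩
  · rw [chainGraph_adj_iff]
    simp only [List.length_append, List.length_cons]
    exact ⟨by omega, by omega, Or.inl trivial⟩
  · simp only [chainGraph_verts, List.length_append, List.length_cons, Finset.mem_range]
    omega
  · ext i
    simp only [WGraph.comap, chainGraph_verts, List.length_append, List.length_cons,
      Finset.mem_range, Finset.mem_insert]
    omega
  · intro i j
    simp only [WGraph.comap, Bool.and_eq_true, decide_eq_true_eq, chainGraph_adj_iff,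
      List.length_append, List.length_cons, Finset.mem_range]
    have := hf i
    have := hf j
    omega
  · have : f m = X.length + 1 := by have := hf m; omega
    simp [WGraph.comap, chainGraph_wt, this]
  · have : f p = X.length := by have := hf p; omega
    simp [WGraph.comap, chainGraph_wt, this, p]
  · have h1 : f (p + 1) = X.length + 2 := by have := hf (p + 1); omega
    simp [WGraph.comap, chainGraph_wt, h1, p]
  · intro i hi h1 h2
    simp only [chainGraph_verts, List.length_append, List.length_cons, Finset.mem_range] at hi
    simp only [WGraph.comap, chainGraph_wt]
    rcases lt_or_ge i p with h | h
    · have : f i = i := by have := hf i; omega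
      rw [this, List.getElem?_append_left h, List.getElem?_append_left h]
    · obtain ⟨k, rfl⟩ : ∃ k, i = X.length + 2 + k := ⟨i - (X.length + 2), by omega⟩
      have : f (X.length + 2 + k) = X.length + 3 + k := by
        have := hf (X.length + 2 + k); omega
      rw [this, List.getElem?_append_right (by omega), List.getElem?_append_right (by omega),
        show X.length + 3 + k - X.length = k + 3 by omega,
        show X.length + 2 + k - X.length = k + 2 by omega]
      simp

theorem wBlowup_chainGraph_last (X : List ℤ) (a : ℤ) :
    WBlowup (chainGraph (X ++ [a])) (chainGraph (X ++ [a - 1, -1])) := by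
  refine Or.inl ⟨X.length, X.length + 1, ?_, ?_, ?_, ?_, ?_, ?_, ?_⟩
  · simp [chainGraph_verts]
  · simp [chainGraph_verts]
  · ext i
    simp only [chainGraph_verts, List.length_append, List.length_cons, List.length_nil,
      Finset.mem_range, Finset.mem_insert]
    omega
  · intro i j
    simp only [chainGraph_adj_iff, List.length_append, List.length_cons, List.length_nil]
    omega
  · simp [chainGraph_wt]
  · simp [chainGraph_wt]
  · intro i hi hne
    simp only [chainGraph_verts, List.length_append, List.length_cons, List.length_nil,
      Finset.mem_range] at hi
    have h : i < X.length := by omega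
    rw [chainGraph_wt, chainGraph_wt, List.getElem?_append_left h, List.getElem?_append_left h]

theorem wBlowup_chainGraph_nil : WBlowup (chainGraph []) (chainGraph [-1]) := by
  refine Or.inr (Or.inr ⟨0, by simp [chainGraph], by simp [chainGraph], fun i j => ?_,
    by simp [chainGraph], by simp [chainGraph]⟩)
  rw [Bool.eq_iff_iff, chainGraph_adj_iff, chainGraph_adj_iff]
  simp only [List.length_nil, List.length_singleton]
  omega

namespace ChainEquiv

theorem reflTransGen {X Y : List ℤ} (h : ChainEquiv X Y) :
    Relation.ReflTransGen IsChainStep (chainGraph X) (chainGraph Y) := by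
  induction h with
  | refl X => exact .refl
  | symm _ ih =>
    have : Std.Symm IsChainStep := ⟨fun _ _ => IsChainStep.symm⟩
    exact Std.Symm.symm _ _ ih
  | trans _ _ ih ih' => exact ih.trans ih'
  | reverse X =>
    exact .single ⟨isLinearChain_chainGraph _, isLinearChain_chainGraph _,
      Or.inr (Or.inr (iso_chainGraph_reverse X))⟩
  | edge X a b Y =>
    obtain ⟨G', hG', hiso⟩ := exists_wBlowup_iso_chainGraph_edge X a b Y
    have hlin : IsLinearChain G' := ⟨_, hiso⟩
    exact .tail (.single ⟨isLinearChain_chainGraph _, hlin, Or.inl hG'⟩)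
      ⟨hlin, isLinearChain_chainGraph _, Or.inr (Or.inr hiso)⟩
  | last X a =>
    exact .single ⟨isLinearChain_chainGraph _, isLinearChain_chainGraph _,
      Or.inl (wBlowup_chainGraph_last X a)⟩
  | nil =>
    exact .single ⟨isLinearChain_chainGraph _, isLinearChain_chainGraph _,
      Or.inl wBlowup_chainGraph_nil⟩

theorem wEquiv {X Y : List ℤ} (h : ChainEquiv X Y) : WEquiv (chainGraph X) (chainGraph Y) :=
  Relation.ReflTransGen.rec (motive := fun G _ => WEquiv (chainGraph X) G) (.refl _)
    (fun _ h ih => ih.trans _ _ _ h.wEquiv) h.reflTransGen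

theorem first (a : ℤ) (X : List ℤ) : ChainEquiv (a :: X) (-1 :: (a - 1) :: X) := by
  have h := (last X.reverse a).trans (reverse _)
  have h' := (reverse (a :: X))
  rw [List.reverse_cons] at h'
  simpa using h'.trans h

/-- The elementary transformation at an interior vertex of weight zero. -/
theorem zero_shift_one (X : List ℤ) (a b : ℤ) (Y : List ℤ) :
    ChainEquiv (X ++ a :: 0 :: b :: Y) (X ++ (a + 1) :: 0 :: (b - 1) :: Y) := by
  have h := edge X (a + 1) 0 ((b - 1) :: Y)
  have h' := edge (X ++ [a]) 0 b Y
  simp only [List.append_assoc, List.singleton_append, add_sub_cancel_right, zero_sub] at h h'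
  exact h'.trans h.symm

theorem zero_shift (X : List ℤ) (a b c : ℤ) (Y : List ℤ) :
    ChainEquiv (X ++ a :: 0 :: b :: Y) (X ++ (a + c) :: 0 :: (b - c) :: Y) := by
  induction c with
  | zero => simpa using refl _
  | succ c ih =>
    rw [← add_assoc, ← sub_sub]
    exact ih.trans (zero_shift_one X _ _ Y)
  | pred c ih =>
    refine ih.trans (symm ?_)
    have h := zero_shift_one X (a + (-(c : ℤ) - 1)) (b - (-(c : ℤ) - 1)) Y
    rwa [show a + (-(c : ℤ) - 1) + 1 = a + -c by ring,
      show b - (-(c : ℤ) - 1) - 1 = b - -c by ring] at h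

theorem zero_first_one (b : ℤ) (Y : List ℤ) :
    ChainEquiv (0 :: b :: Y) (0 :: (b - 1) :: Y) := by
  have h := first 0 ((b - 1) :: Y)
  have h' := edge [] 0 b Y
  simp only [List.nil_append, zero_sub] at h h'
  exact h'.trans h.symm

theorem zero_first (b c : ℤ) (Y : List ℤ) :
    ChainEquiv (0 :: b :: Y) (0 :: (b - c) :: Y) := by
  induction c with
  | zero => simpa using refl _
  | succ c ih =>
    rw [← sub_sub]
    exact ih.trans (zero_first_one _ Y)
  | pred c ih =>
    refine ih.trans (symm ?_)
    have h := zero_first_one (b - (-(c : ℤ) - 1)) Y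
    rwa [show b - (-(c : ℤ) - 1) - 1 = b - -c by ring] at h

theorem move_zeros (X Y : List ℤ) : ChainEquiv (X ++ 0 :: 0 :: Y) (0 :: 0 :: (X ++ Y)) := by
  induction X using List.reverseRecOn generalizing Y with
  | nil => exact refl _
  | append_singleton X a ih =>
    have h := zero_shift X a 0 (-a) Y
    simp only [add_neg_cancel, zero_sub, neg_neg] at h
    simpa using h.trans (ih (a :: Y))

theorem zeros_cons {X Y : List ℤ} (h : ChainEquiv X Y) :
    ChainEquiv (0 :: 0 :: X) (0 :: 0 :: Y) := by
  induction h with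
  | refl X => exact refl _
  | symm _ ih => exact ih.symm
  | trans _ _ ih ih' => exact ih.trans ih'
  | reverse X =>
    have h := (reverse (0 :: 0 :: X))
    simp only [List.reverse_cons, List.append_assoc, List.singleton_append] at h
    simpa using h.trans (move_zeros X.reverse [])
  | edge X a b Y => exact edge (0 :: 0 :: X) a b Y
  | last X a => exact last (0 :: 0 :: X) a
  | nil =>
    have h := last [0] 0
    exact h.trans (zero_first _ (-1) [-1])

end ChainEquiv

/-! ### Reduction to a normal form -/

/-- The sequence `X` preceded by `2 * i` zeros. -/
def zerosAppend (i : ℕ) (X : List ℤ) : List ℤ := (fun l => 0 :: 0 :: l)^[i] X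

theorem zerosAppend_succ (i : ℕ) (X : List ℤ) :
    zerosAppend (i + 1) X = 0 :: 0 :: zerosAppend i X :=
  Function.iterate_succ_apply' _ _ _

/-- The sequences which, preceded by pairs of zeros, serve as normal forms. -/
def IsTerminal (X : List ℤ) : Prop := (∀ x ∈ X, x ≤ -2) ∨ X = [0]

namespace ChainEquiv

theorem zerosAppend {X Y : List ℤ} (h : ChainEquiv X Y) (i : ℕ) :
    ChainEquiv (zerosAppend i X) (zerosAppend i Y) := by
  induction i with
  | zero => exact h
  | succ i ih =>
    rw [zerosAppend_succ, zerosAppend_succ]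
    exact ih.zeros_cons

theorem exists_zeros_of_zero (X Y : List ℤ) (h : X ≠ [] ∨ Y ≠ []) :
    ∃ Z, ChainEquiv (X ++ 0 :: Y) (0 :: 0 :: Z) := by
  have start : ∀ (b : ℤ) (Y : List ℤ), ChainEquiv (0 :: b :: Y) (0 :: 0 :: Y) := fun b Y => by
    simpa using zero_first b b Y
  rcases List.eq_nil_or_concat X with rfl | ⟨X, a, rfl⟩
  · obtain ⟨b, Y, rfl⟩ := List.exists_cons_of_ne_nil (h.resolve_left (by simp))
    exact ⟨Y, start b Y⟩
  · rcases Y with _ | ⟨b, Y⟩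
    · refine ⟨X.reverse, (reverse _).trans ?_⟩
      simpa using start a X.reverse
    · refine ⟨X ++ (b - (-a)) :: Y, ?_⟩
      have h := zero_shift X a b (-a) Y
      rw [add_neg_cancel] at h
      simpa using h.trans (move_zeros X _)

theorem exists_zeros_of_natCast (n : ℕ) (X Y : List ℤ) (h : n ≠ 0 ∨ X ≠ [] ∨ Y ≠ []) :
    ∃ Z, ChainEquiv (X ++ (n : ℤ) :: Y) (0 :: 0 :: Z) := by
  induction n generalizing Y with
  | zero => exact exists_zeros_of_zero X Y (h.resolve_left (by simp))
  | succ n ih =>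
    rcases Y with _ | ⟨b, Y⟩
    · obtain ⟨Z, hZ⟩ := ih [-1] (by simp)
      have h := last X ((n + 1 : ℕ) : ℤ)
      rw [Nat.cast_succ, add_sub_cancel_right] at h
      exact ⟨Z, h.trans hZ⟩
    · obtain ⟨Z, hZ⟩ := ih (-1 :: (b - 1) :: Y) (by simp)
      have h := edge X ((n + 1 : ℕ) : ℤ) b Y
      rw [Nat.cast_succ, add_sub_cancel_right] at h
      exact ⟨Z, h.trans hZ⟩

theorem exists_shorter (X Y : List ℤ) :
    ∃ Z : List ℤ, Z.length < (X ++ -1 :: Y).length ∧ ChainEquiv (X ++ -1 :: Y) Z := by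
  rcases List.eq_nil_or_concat X with rfl | ⟨X, a, rfl⟩
  · rcases Y with _ | ⟨b, Y⟩
    · exact ⟨[], by simp, nil.symm⟩
    · have h := first (b + 1) Y
      rw [add_sub_cancel_right] at h
      exact ⟨_, by simp, h.symm⟩
  · rcases Y with _ | ⟨b, Y⟩
    · have h := last X (a + 1)
      rw [add_sub_cancel_right] at h
      exact ⟨X ++ [a + 1], by simp, by simpa using h.symm⟩
    · have h := edge X (a + 1) (b + 1) Y
      rw [add_sub_cancel_right, add_sub_cancel_right] at h
      exact ⟨X ++ (a + 1) :: (b + 1) :: Y, by simp, by simpa using h.symm⟩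

end ChainEquiv

theorem WGraph.hasPosRank_zero (G : WGraph) : G.HasPosRank 0 :=
  ⟨0, fun x hx => absurd (Subsingleton.elim x 0) hx⟩

theorem WGraph.HasPosRank.zeros_cons {X : List ℤ} {k : ℕ} (h : (chainGraph X).HasPosRank k) :
    (chainGraph (0 :: 0 :: X)).HasPosRank (k + 1) := by
  obtain ⟨f, hf⟩ := h
  let c : ℚ := if X = [] then 0 else 1
  let f' : (Fin (k + 1) → ℚ) →ₗ[ℚ] (ℕ → ℚ) :=
    { toFun := fun z i => match i with
        | 0 => z 0 - c * f (Fin.tail z) 0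
        | 1 => z 0
        | i + 2 => f (Fin.tail z) i
      map_add' := fun z w => by
        have : Fin.tail (z + w) = Fin.tail z + Fin.tail w := rfl
        ext i
        rcases i with _ | _ | i <;> simp [this]
        ring
      map_smul' := fun a z => by
        have : Fin.tail (a • z) = a • Fin.tail z := rfl
        ext i
        rcases i with _ | _ | i <;> simp [this]
        ring }
  refine ⟨f', fun z hz => ?_⟩
  have hquad : (chainGraph (0 :: 0 :: X)).quad (f' z) =
      2 * z 0 ^ 2 + (chainGraph X).quad (f (Fin.tail z)) := by
    have h0 : f' z 0 = z 0 - c * f (Fin.tail z) 0 := rfl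
    have h1 : f' z 1 = z 0 := rfl
    have h2 : ∀ i, f' z (i + 2) = f (Fin.tail z) i := fun _ => rfl
    rw [quad_chainGraph, quad_chainGraph, chainQuad, chainQuad]
    have h2' : f' z 2 = f (Fin.tail z) 0 := rfl
    simp only [h0, h1, h2, zero_add, add_assoc, one_add_one_eq_two, h2', c]
    split_ifs <;> simp_all <;> ring
  rw [hquad]
  by_cases ht : Fin.tail z = 0
  · have hz0 : z 0 ≠ 0 := by
      rintro h0
      apply hz
      rw [← Fin.cons_self_tail z, h0, ht]
      ext i
      refine Fin.cases ?_ (fun i => ?_) i <;> simp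
    rw [ht, map_zero]
    have : (chainGraph X).quad 0 = 0 := by simp [WGraph.quad]
    rw [this]
    positivity
  · have := hf _ ht
    positivity

/-- The quadratic form of the chain `X` is negative semidefinite on some subspace
of codimension at most `k`. -/
def HasNonposCorank (X : List ℤ) (k : ℕ) : Prop :=
  ∃ φ : (ℕ → ℚ) →ₗ[ℚ] (Fin k → ℚ), ∀ y, φ y = 0 → chainQuad X y ≤ 0

namespace HasNonposCorank

theorem cons {X : List ℤ} {k : ℕ} (h : HasNonposCorank X k) (x : ℤ) :
    HasNonposCorank (x :: X) (k + 1) := by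
  obtain ⟨φ, hφ⟩ := h
  refine ⟨(LinearMap.proj 0).vecCons (φ.comp (LinearMap.funLeft ℚ ℚ (· + 1))), fun y hy => ?_⟩
  have h0 : y 0 = 0 := congrFun hy 0
  have h1 : φ (fun i => y (i + 1)) = 0 := funext fun i => congrFun hy i.succ
  simpa [chainQuad, h0] using hφ _ h1

theorem zeros_cons {X : List ℤ} {k : ℕ} (h : HasNonposCorank X k) :
    HasNonposCorank (0 :: 0 :: X) (k + 1) := by
  obtain ⟨φ, hφ⟩ := h
  refine ⟨(LinearMap.proj 1).vecCons (φ.comp (LinearMap.funLeft ℚ ℚ (· + 2))), fun y hy => ?_⟩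
  have h0 : y 1 = 0 := congrFun hy 0
  have h1 : φ (fun i => y (i + 2)) = 0 := funext fun i => congrFun hy i.succ
  simpa [chainQuad, h0, add_assoc] using hφ _ h1

theorem length (X : List ℤ) : HasNonposCorank X X.length := by
  induction X with
  | nil => exact ⟨0, fun _ _ => le_rfl⟩
  | cons x X ih => exact ih.cons x

theorem of_isTerminal {X : List ℤ} (h : IsTerminal X) : HasNonposCorank X 0 := by
  refine ⟨0, fun y hy => ?_⟩
  clear hy
  rcases h with h | rfl
  · have key : chainQuad X y ≤ if X = [] then 0 else -(y 0) ^ 2 := by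
      induction X generalizing y with
      | nil => simp [chainQuad]
      | cons x X ih =>
        have ih' := ih (fun i => y (i + 1)) (fun z hz => h z (List.mem_cons_of_mem _ hz))
        have hx : (x : ℚ) ≤ -2 := by exact_mod_cast h x List.mem_cons_self
        have hx' := mul_le_mul_of_nonneg_right hx (sq_nonneg (y 0))
        rw [chainQuad, if_neg (List.cons_ne_nil _ _)]
        split_ifs at ih' ⊢
        · linarith [sq_nonneg (y 0)]
        · simp only [zero_add] at ih'
          linarith [sq_nonneg (y 0 - y 1), sub_sq (y 0) (y 1)]
    refine key.trans ?_
    split_ifs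
    · exact le_rfl
    · linarith [sq_nonneg (y 0)]
  · simp [chainQuad]

theorem le {X : List ℤ} {k l : ℕ} (h : HasNonposCorank X l) (hk : (chainGraph X).HasPosRank k) :
    k ≤ l := by
  obtain ⟨φ, hφ⟩ := h
  obtain ⟨f, hf⟩ := hk
  by_contra! hlt
  have hker : LinearMap.ker (φ.comp f) ≠ ⊥ :=
    LinearMap.ker_ne_bot_of_finrank_lt (by simpa using hlt)
  obtain ⟨x, hx, hx0⟩ := Submodule.exists_mem_ne_zero_of_ne_bot hker
  have h1 := hf x hx0
  rw [quad_chainGraph] at h1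
  exact absurd (hφ _ hx) (not_le.2 h1)

end HasNonposCorank

theorem hasPosRank_and_hasNonposCorank_zerosAppend {X : List ℤ} (hX : IsTerminal X) (i : ℕ) :
    (chainGraph (zerosAppend i X)).HasPosRank i ∧ HasNonposCorank (zerosAppend i X) i := by
  induction i with
  | zero => exact ⟨WGraph.hasPosRank_zero _, .of_isTerminal hX⟩
  | succ i ih =>
    rw [zerosAppend_succ]
    exact ⟨ih.1.zeros_cons, ih.2.zeros_cons⟩

theorem exists_chainEquiv_zerosAppend_of_not_hasPosRank (N : ℕ) (X : List ℤ)
    (hX : ¬ (chainGraph X).HasPosRank N) :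
    ∃ i A, IsTerminal A ∧ ChainEquiv X (zerosAppend i A) := by
  induction N generalizing X with
  | zero => exact absurd (WGraph.hasPosRank_zero _) hX
  | succ N ihN =>
    induction hlen : X.length using Nat.strong_induction_on generalizing X with
    | _ m ih =>
    by_cases hterm : IsTerminal X
    · exact ⟨0, X, hterm, .refl X⟩
    rw [IsTerminal, not_or] at hterm
    obtain ⟨hneg, hne⟩ := hterm
    push Not at hneg
    obtain ⟨x, hx, hx2⟩ := hneg
    obtain ⟨Y, Z, rfl⟩ := List.append_of_mem hx
    rcases lt_or_ge x 0 with hx0 | hx0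
    · obtain rfl : x = -1 := by omega
      obtain ⟨W, hW, hYW⟩ := ChainEquiv.exists_shorter Y Z
      obtain ⟨i, A, hA, hWA⟩ := ih _ (hlen ▸ hW) W
        (fun h => hX ((hYW.wEquiv.hasPosRank_iff _).2 h)) rfl
      exact ⟨i, A, hA, hYW.trans hWA⟩
    · lift x to ℕ using hx0
      obtain ⟨W, hW⟩ := ChainEquiv.exists_zeros_of_natCast x Y Z (by
        by_contra! h
        obtain ⟨rfl, rfl, rfl⟩ := h
        exact hne rfl)
      obtain ⟨i, A, hA, hWA⟩ := ihN W
        (fun h => hX ((hW.wEquiv.hasPosRank_iff _).2 h.zeros_cons))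
      refine ⟨i + 1, A, hA, hW.trans ?_⟩
      rw [zerosAppend_succ]
      exact hWA.zeros_cons

theorem exists_chainEquiv_zerosAppend (X : List ℤ) :
    ∃ i A, IsTerminal A ∧ ChainEquiv X (zerosAppend i A) :=
  exists_chainEquiv_zerosAppend_of_not_hasPosRank (X.length + 1) X fun h =>
    absurd ((HasNonposCorank.length X).le h) (by simp)

/-! ### Uniqueness of the normal form -/

theorem chainFrac_zerosAppend (i : ℕ) (X : List ℤ) :
    chainFrac (zerosAppend i X) = ((-1) ^ i * (chainFrac X).1, (-1) ^ i * (chainFrac X).2) := by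
  induction i with
  | zero => simp [zerosAppend]
  | succ i ih =>
    rw [zerosAppend_succ, chainFrac, chainFrac, ih]
    ext <;> simp [pow_succ]

theorem chainFrac_bounds {X : List ℤ} (h : ∀ x ∈ X, x ≤ -2) :
    0 ≤ (chainFrac X).2 ∧ (chainFrac X).2 < (chainFrac X).1 := by
  induction X with
  | nil => simp [chainFrac]
  | cons x X ih =>
    obtain ⟨h1, h2⟩ := ih fun z hz => h z (List.mem_cons_of_mem _ hz)
    have hx := h x List.mem_cons_self
    simp only [chainFrac]
    constructor <;> nlinarith

theorem chainFrac_injOn {X Y : List ℤ} (hX : ∀ x ∈ X, x ≤ -2) (hY : ∀ y ∈ Y, y ≤ -2)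
    (h : chainFrac X = chainFrac Y) : X = Y := by
  induction X generalizing Y with
  | nil =>
    rcases Y with _ | ⟨y, Y⟩
    · rfl
    · have := chainFrac_bounds fun z hz => hY z (List.mem_cons_of_mem _ hz)
      simp only [chainFrac, Prod.mk.injEq] at h
      omega
  | cons x X ih =>
    have hbX := chainFrac_bounds fun z hz => hX z (List.mem_cons_of_mem _ hz)
    rcases Y with _ | ⟨y, Y⟩
    · simp only [chainFrac, Prod.mk.injEq] at h
      omega
    · have hbY := chainFrac_bounds fun z hz => hY z (List.mem_cons_of_mem _ hz)
      simp only [chainFrac, Prod.mk.injEq] at h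
      obtain ⟨h1, h2⟩ := h
      rw [← h2] at h1 hbY
      have hxy : x = y := by
        have hlt : |(x - y) * (chainFrac X).1| < (chainFrac X).1 := by
          rw [abs_lt]; constructor <;> linarith
        have := Int.eq_zero_of_abs_lt_dvd (Dvd.intro_left _ rfl) hlt
        rcases mul_eq_zero.1 this with h | h <;> omega
      subst hxy
      rw [ih (fun z hz => hX z (List.mem_cons_of_mem _ hz))
        (fun z hz => hY z (List.mem_cons_of_mem _ hz)) (Prod.ext h2 (by linarith))]

/-- The product of elementary matrices whose first column is `chainFrac X`. -/
def chainMatrix (X : List ℤ) : Matrix (Fin 2) (Fin 2) ℤ :=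
  (X.map fun x => !![-x, -1; 1, 0]).prod

theorem chainFrac_eq_chainMatrix (X : List ℤ) :
    chainFrac X = (chainMatrix X 0 0, chainMatrix X 1 0) := by
  induction X with
  | nil => simp [chainFrac, chainMatrix]
  | cons x X ih =>
    rw [chainFrac, ih]
    simp [chainMatrix, Matrix.mul_apply, Fin.sum_univ_two]
    ring

theorem det_chainMatrix (X : List ℤ) : (chainMatrix X).det = 1 := by
  induction X with
  | nil => simp [chainMatrix]
  | cons x X ih =>
    rw [chainMatrix, List.map_cons, List.prod_cons, Matrix.det_mul, ← chainMatrix, ih]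
    simp [Matrix.det_fin_two]

theorem chainMatrix_reverse (X : List ℤ) : chainMatrix X.reverse =
    !![chainMatrix X 0 0, -chainMatrix X 1 0; -chainMatrix X 0 1, chainMatrix X 1 1] := by
  induction X with
  | nil => ext i j; fin_cases i <;> fin_cases j <;> simp [chainMatrix]
  | cons x X ih =>
    have : chainMatrix (x :: X).reverse = chainMatrix X.reverse * !![-x, -1; 1, 0] := by
      simp [chainMatrix]
    have h : chainMatrix (x :: X) = !![-x, -1; 1, 0] * chainMatrix X := by simp [chainMatrix]
    rw [this, ih, h]
    ext i j
    fin_cases i <;> fin_cases j <;> simp [Matrix.mul_apply, Fin.sum_univ_two] <;> ring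

theorem exists_chainFrac_reverse (X : List ℤ) : ∃ w z, chainFrac X.reverse = ((chainFrac X).1, w) ∧
    (chainFrac X).1 * z + (chainFrac X).2 * w = 1 := by
  refine ⟨-chainMatrix X 0 1, chainMatrix X 1 1, ?_, ?_⟩
  · simp [chainFrac_eq_chainMatrix, chainMatrix_reverse]
  · have := det_chainMatrix X
    rw [Matrix.det_fin_two] at this
    simp only [chainFrac_eq_chainMatrix]
    linarith

theorem eq_or_swap_of_forall_add_eq {A : Type*} [Zero A] {a b c d : A} (ha : a ≠ 0) (hb : b ≠ 0)
    (h : ∀ F : A → ℤ, F 0 = 0 → F a + F b = F c + F d) : (a = c ∧ b = d) ∨ (a = d ∧ b = c) := by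
  classical
  have h1 := h (fun z => if z = a then 1 else 0) (by simp [ha.symm])
  have h2 := h (fun z => if z = b then 1 else 0) (by simp [hb.symm])
  by_cases hac : c = a <;> by_cases had : d = a <;> by_cases hbc : c = b <;>
    by_cases hbd : d = b <;> by_cases hab : a = b <;> simp_all

theorem dvd_of_wEquiv_zerosAppend {A B : List ℤ} (i : ℕ) (hA : ∀ x ∈ A, x ≤ -2)
    (h : WEquiv (chainGraph (zerosAppend i A)) (chainGraph (zerosAppend i B))) :
    (chainFrac A).1 ∣ (chainFrac B).1 ∧ ((chainFrac A).1 ∣ (chainFrac A).2 - (chainFrac B).2 ∨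
      (chainFrac A).1 ∣ (chainFrac A).2 * (chainFrac B).2 - 1) := by
  have hb := chainFrac_bounds hA
  obtain ⟨w, z, -, hw⟩ := exists_chainFrac_reverse A
  have hfA := chainFrac_zerosAppend i A
  have hfB := chainFrac_zerosAppend i B
  generalize (chainFrac A).1 = n, (chainFrac A).2 = q at *
  generalize (chainFrac B).1 = n', (chainFrac B).2 = q' at *
  have hσ : ((-1 : ℤ) ^ i) * (-1) ^ i = 1 := by rw [← mul_pow]; simp
  generalize (-1 : ℤ) ^ i = σ at *
  lift n to ℕ using by omega
  rcases Nat.lt_or_ge n 2 with hn | hn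
  · obtain rfl : n = 1 := by omega
    simp
  have : Fact (1 < n) := ⟨hn⟩
  simp only [← ZMod.intCast_zmod_eq_zero_iff_dvd] at *
  have hσ' : (σ : ZMod n) * σ = 1 := by exact_mod_cast congrArg (Int.cast : ℤ → ZMod n) hσ
  have hw' : (q : ZMod n) * w = 1 := by
    have := congrArg (Int.cast : ℤ → ZMod n) hw
    push_cast at this
    simpa using this
  obtain ⟨t, ht, hF⟩ := h.exists_chainFrac_smul (A := ZMod n) (t := 1) (by simp [hfA])
  simp only [hfA, hfB, zsmul_eq_mul, mul_one, Int.cast_mul] at ht hF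
  have hne : (σ : ZMod n) * q ≠ 0 := fun h0 => by
    have : (σ * q : ZMod n) * (σ * w) = 1 := by linear_combination q * w * hσ' + hw'
    rw [h0, zero_mul] at this
    exact zero_ne_one this
  push_cast
  rcases eq_or_swap_of_forall_add_eq hne one_ne_zero hF with ⟨h1, h2⟩ | ⟨h1, h2⟩
  · subst h2
    refine ⟨by linear_combination σ * ht - n' * hσ', Or.inl ?_⟩
    linear_combination σ * h1 - (q - q') * hσ'
  · subst h1
    refine ⟨?_, Or.inr ?_⟩
    · linear_combination w * ht - (n' * q * w) * hσ' - n' * hw'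
    · linear_combination -h2 - q * q' * hσ'

theorem not_wEquiv_zerosAppend_zero {A : List ℤ} (i : ℕ) (hA : ∀ x ∈ A, x ≤ -2) :
    ¬ WEquiv (chainGraph (zerosAppend i [0])) (chainGraph (zerosAppend i A)) := by
  intro h
  have hb := chainFrac_bounds hA
  have hσ : (-1 : ℤ) ^ i ≠ 0 := by simp
  obtain ⟨t, ht, hF⟩ := h.exists_chainFrac_smul (A := ℤ) (t := 1)
    (by simp [chainFrac_zerosAppend, chainFrac])
  have hn : (chainFrac A).1 ≠ 0 := by omega
  obtain rfl : t = 0 := by simpa [chainFrac_zerosAppend, hn] using ht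
  have := hF (fun z => if z = 0 then 0 else 1) (by simp)
  simp [chainFrac_zerosAppend, chainFrac] at this

theorem eq_or_eq_reverse_of_wEquiv_zerosAppend {A B : List ℤ} (i : ℕ) (hA : IsTerminal A)
    (hB : IsTerminal B)
    (h : WEquiv (chainGraph (zerosAppend i A)) (chainGraph (zerosAppend i B))) :
    A = B ∨ A = B.reverse := by
  rcases hA with hA | rfl
  · rcases hB with hB | rfl
    · obtain ⟨h1, h2⟩ := dvd_of_wEquiv_zerosAppend i hA h
      obtain ⟨h1', -⟩ := dvd_of_wEquiv_zerosAppend i hB (h.symm _ _)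
      have hbA := chainFrac_bounds hA
      have hbB := chainFrac_bounds hB
      have hn : (chainFrac A).1 = (chainFrac B).1 :=
        Int.dvd_antisymm (by omega) (by omega) h1 h1'
      rcases h2 with h2 | h2
      · refine Or.inl (chainFrac_injOn hA hB (Prod.ext hn ?_))
        exact sub_eq_zero.1 (Int.eq_zero_of_abs_lt_dvd h2 (abs_lt.2 ⟨by omega, by omega⟩))
      · have hB' : ∀ x ∈ B.reverse, x ≤ -2 := fun x hx => hB x (List.mem_reverse.1 hx)
        have hbB' := chainFrac_bounds hB'
        obtain ⟨w, z, hr, hw⟩ := exists_chainFrac_reverse B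
        rw [hr] at hbB'
        refine Or.inr (chainFrac_injOn hA hB' ?_)
        rw [hr]
        refine Prod.ext hn (sub_eq_zero.1 (Int.eq_zero_of_abs_lt_dvd (m := (chainFrac A).1) ?_
          (abs_lt.2 ⟨by dsimp only at *; omega, by dsimp only at *; omega⟩)))
        obtain ⟨c, hc⟩ := h2
        rw [← hn] at hw
        exact ⟨c * w + z * (chainFrac A).2, by linear_combination w * hc - (chainFrac A).2 * hw⟩
    · exact absurd (h.symm _ _) (not_wEquiv_zerosAppend_zero i hA)
  · rcases hB with hB | rfl
    · exact absurd h (not_wEquiv_zerosAppend_zero i hB)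
    · exact Or.inl rfl

theorem WEquiv.chainEquiv {X Y : List ℤ} (h : WEquiv (chainGraph X) (chainGraph Y)) :
    ChainEquiv X Y := by
  obtain ⟨i, A, hA, hXA⟩ := exists_chainEquiv_zerosAppend X
  obtain ⟨j, B, hB, hYB⟩ := exists_chainEquiv_zerosAppend Y
  have hAB : WEquiv (chainGraph (zerosAppend i A)) (chainGraph (zerosAppend j B)) :=
    ((hXA.wEquiv.symm _ _).trans _ _ _ h).trans _ _ _ hYB.wEquiv
  obtain ⟨hi, hi'⟩ := hasPosRank_and_hasNonposCorank_zerosAppend hA i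
  obtain ⟨hj, hj'⟩ := hasPosRank_and_hasNonposCorank_zerosAppend hB j
  obtain rfl : i = j := le_antisymm (hj'.le ((hAB.hasPosRank_iff i).1 hi))
    (hi'.le ((hAB.hasPosRank_iff j).2 hj))
  refine (hXA.trans ?_).trans hYB.symm
  rcases eq_or_eq_reverse_of_wEquiv_zerosAppend i hA hB hAB with rfl | rfl
  · exact .refl _
  · exact (ChainEquiv.reverse B).symm.zerosAppend i

theorem exists_path_of_reflTransGen {L L' : WGraph} (hL : IsLinearChain L)
    (h : Relation.ReflTransGen IsChainStep L L') :
    ∃ (n : ℕ) (g : ℕ → WGraph), g 0 = L ∧ g n = L' ∧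
      (∀ i < n, WBlowup (g i) (g (i + 1)) ∨ WBlowup (g (i + 1)) (g i) ∨
        WGraph.Iso (g i) (g (i + 1))) ∧
      (∀ i ≤ n, IsLinearChain (g i)) := by
  induction h with
  | refl => exact ⟨0, fun _ => L, rfl, rfl, by simp, fun _ _ => hL⟩
  | @tail M M' _ hstep ih =>
    obtain ⟨n, g, h0, hn, hs, hl⟩ := ih
    refine ⟨n + 1, fun i => if i ≤ n then g i else M', by simpa using h0, by simp, ?_, ?_⟩
    · intro i hi
      rcases Nat.lt_succ_iff_lt_or_eq.1 hi with hi | rfl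
      · simpa [hi.le, Nat.succ_le_of_lt hi] using hs i hi
      · simpa [hn] using hstep.2.2
    · intro i _
      dsimp only
      split_ifs with h
      · exact hl i h
      · exact hstep.2.1

/-- **Corollary.** If `ℒ` and `ℒ'` are equivalent linear chains, then some finite
sequence of blowings-up and blowings-down transforms `ℒ` into `ℒ'` in such a way
that every weighted graph occurring in the sequence is itself a linear chain. -/
theorem equivalent_linear_chains_via_linear_chains (L L' : WGraph)
    (hL : IsLinearChain L) (hL' : IsLinearChain L') (h : WEquiv L L') :
    ∃ (n : ℕ) (g : ℕ → WGraph), g 0 = L ∧ g n = L' ∧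
      (∀ i < n, WBlowup (g i) (g (i + 1)) ∨ WBlowup (g (i + 1)) (g i) ∨
        WGraph.Iso (g i) (g (i + 1))) ∧
      (∀ i ≤ n, IsLinearChain (g i)) := by
  obtain ⟨X, hX⟩ := id hL
  obtain ⟨Y, hY⟩ := id hL'
  have hXY : WEquiv (chainGraph X) (chainGraph Y) :=
    .trans _ _ _ (.trans _ _ _ (.rel _ _ (Or.inr hX.symm)) h) (.rel _ _ (Or.inr hY))
  refine exists_path_of_reflTransGen hL (Relation.ReflTransGen.trans
    (.single ⟨hL, isLinearChain_chainGraph X, Or.inr (Or.inr hX)⟩)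
    (hXY.chainEquiv.reflTransGen.tail
      ⟨isLinearChain_chainGraph Y, hL', Or.inr (Or.inr hY.symm)⟩))
end
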